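/- arXiv:1403.7320 — 3 statements merged into one kernel-verified Lean document; each statement's English description precedes it below -/
import Mathlib

section
/- Let a = (a_1,…,a_n) ∈ F^n with a ≠ 0. Then for every c ∈ F, the only F-linear subspaces of A invariant under all operators P^a_{i,j} (i ≠ j, i,j ∈ {1,…,n+1}) and P^a_{i,i} − P^a_{j,j} (i,j ∈ {1,…,n+1}) are {0} and A. (These operators realize the action of sl(n+1,F) on the space A_a = A·e^{a·x} of exponential-polynomial functions, transported to A.) -/
open MvPolynomial

/-- Multiplication by `x i` as an `F`-linear endomorphism of `A = F[x_1,…,x_n]`. -/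
noncomputable def mulX (F : Type*) [Field F] (n : ℕ) (i : Fin n) :
    Module.End F (MvPolynomial (Fin n) F) :=
  LinearMap.mulLeft F (X i)

/-- The twisted partial derivative `∂_i + a_i·id` (conjugation of `∂_i` by `e^{a·x}`). -/
noncomputable def pda (F : Type*) [Field F] (n : ℕ) (a : Fin n → F) (i : Fin n) :
    Module.End F (MvPolynomial (Fin n) F) :=
  (pderiv i).toLinearMap + a i • 1

/-- The twisted Euler operator `D_a = Σ_s x_s ∘ (∂_s + a_s·id)`. -/
noncomputable def Da (F : Type*) [Field F] (n : ℕ) (a : Fin n → F) :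
    Module.End F (MvPolynomial (Fin n) F) :=
  ∑ s : Fin n, mulX F n s * pda F n a s

/-- The operators `P^a_{i,j}`, realizing the projective oscillator representation `π_c`
on `A·e^{a·x}`, transported to `A`; index `n` plays the role of the paper's index `n+1`. -/
noncomputable def Pa (F : Type*) [Field F] (n : ℕ) (a : Fin n → F) (c : F)
    (i j : Fin (n + 1)) : Module.End F (MvPolynomial (Fin n) F) :=
  if hi : (i : ℕ) < n then
    if hj : (j : ℕ) < n then mulX F n ⟨i, hi⟩ * pda F n a ⟨j, hj⟩
    else mulX F n ⟨i, hi⟩ * (Da F n a + c • 1)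
  else
    if hj : (j : ℕ) < n then -pda F n a ⟨j, hj⟩
    else -(Da F n a + c • 1)

theorem aux_deg {F : Type*} [Field F] {n : ℕ} (i : Fin n) (f : MvPolynomial (Fin n) F)
    (h : pderiv i f ≠ 0) : (pderiv i f).totalDegree < f.totalDegree := by
  have key : ∀ m ∈ (pderiv i f).support, (m.sum fun _ e => e) + 1 ≤ f.totalDegree := by
    intro m hm
    rw [mem_support_iff, coeff_pderiv] at hm
    have h1 : m + Finsupp.single i 1 ∈ f.support := by
      rw [mem_support_iff]
      intro h0
      apply hm
      rw [h0]
      simp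
    have h2 := le_totalDegree h1
    rw [Finsupp.sum_add_index' (by simp) (by simp)] at h2
    simpa using h2
  obtain ⟨m, hm⟩ := support_nonempty.mpr h
  have h0 := key m hm
  rw [totalDegree, Finset.sup_lt_iff (by simp only [Nat.bot_eq_zero]; omega)]
  intro b hb
  have := key b hb
  omega

theorem aux_const {F : Type*} [Field F] [CharZero F] {n : ℕ} (f : MvPolynomial (Fin n) F)
    (h : ∀ i, pderiv i f = 0) : f = C (coeff 0 f) := by
  ext m
  rw [coeff_C]
  split_ifs with hm
  · rw [hm]
  · have : ∃ i, m i ≠ 0 := by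
      by_contra! hh
      exact hm (by ext i; simp [hh i])
    obtain ⟨i, hi⟩ := this
    have h1 := congrArg (coeff (m - Finsupp.single i 1)) (h i)
    have h2 : m - Finsupp.single i 1 + Finsupp.single i 1 = m := by
      apply tsub_add_cancel_of_le
      simpa using Nat.one_le_iff_ne_zero.mpr hi
    rw [coeff_pderiv, h2, coeff_zero, mul_eq_zero] at h1
    rcases h1 with h1 | h1
    · exact h1
    · exact absurd h1 (Nat.cast_add_one_ne_zero _)

theorem aux_one {F : Type*} [Field F] [CharZero F] {n : ℕ}
    (W : Submodule F (MvPolynomial (Fin n) F))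
    (hd : ∀ i, ∀ f ∈ W, pderiv i f ∈ W) :
    ∀ (k : ℕ) (f : MvPolynomial (Fin n) F), f.totalDegree ≤ k → f ∈ W → f ≠ 0 → 1 ∈ W := by
  intro k
  induction k with
  | zero =>
    intro f hk hf h0
    have h1 := (totalDegree_eq_zero_iff_eq_C).mp (Nat.le_zero.mp hk)
    have h2 : coeff 0 f ≠ 0 := by
      intro h; rw [h, C_0] at h1; exact h0 h1
    have h3 := W.smul_mem (coeff 0 f)⁻¹ hf
    rw [h1, smul_eq_C_mul, ← C_mul] at h3
    simpa [h2] using h3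
  | succ k ih =>
    intro f hk hf h0
    by_cases h : ∀ i, pderiv i f = 0
    · have h1 := aux_const f h
      exact ih f (by rw [h1, totalDegree_C]; omega) hf h0
    · push Not at h
      obtain ⟨i, hi⟩ := h
      have := aux_deg i f hi
      exact ih _ (by omega) (hd i f hf) hi

theorem aux_mul {F : Type*} [Field F] {n : ℕ}
    (W : Submodule F (MvPolynomial (Fin n) F)) (a : F) (ha : a ≠ 0) (i j : Fin n)
    (hd : ∀ f ∈ W, pderiv j f ∈ W)
    (hx : ∀ f ∈ W, X i * (pderiv j f + a • f) ∈ W) :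
    ∀ (k : ℕ) (f : MvPolynomial (Fin n) F), f.totalDegree < k → f ∈ W → X i * f ∈ W := by
  intro k
  induction k with
  | zero => intro f hk; omega
  | succ k ih =>
    intro f hk hf
    have h1 : X i * pderiv j f ∈ W := by
      by_cases h : pderiv j f = 0
      · rw [h, mul_zero]; exact W.zero_mem
      · have := aux_deg j f h
        exact ih _ (by omega) (hd f hf)
    have h2 := W.smul_mem a⁻¹ (W.sub_mem (hx f hf) h1)
    rw [mul_add, add_sub_cancel_left, mul_smul_comm, smul_smul, inv_mul_cancel₀ ha, one_smul] at h2
    exact h2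

/-- if `a ≠ 0`, then for every `c` the only subspaces of `A` invariant under
all `P^a_{i,j}` (`i ≠ j`) and `P^a_{i,i} − P^a_{j,j}` are `{0}` and `A`. -/
theorem stmt_6 (F : Type*) [Field F] [CharZero F] (n : ℕ) (hn : 2 ≤ n)
    (a : Fin n → F) (ha : a ≠ 0) (c : F) :
    ∀ W : Submodule F (MvPolynomial (Fin n) F),
      (∀ i j : Fin (n + 1), i ≠ j → ∀ f ∈ W, Pa F n a c i j f ∈ W) →
      (∀ i j : Fin (n + 1), ∀ f ∈ W, (Pa F n a c i i - Pa F n a c j j) f ∈ W) →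
      W = ⊥ ∨ W = ⊤ := by
  intro W h1 h2
  by_cases hW : W = ⊥
  · exact Or.inl hW
  right
  have hpda : ∀ j, ∀ f ∈ W, pda F n a j f ∈ W := by
    intro j f hf
    have := h1 (Fin.last n) j.castSucc (Fin.castSucc_lt_last j).ne' f hf
    simpa [Pa] using this
  have hd : ∀ j, ∀ f ∈ W, pderiv j f ∈ W := by
    intro j f hf
    have := W.sub_mem (hpda j f hf) (W.smul_mem (a j) hf)
    simpa [pda] using this
  have hii : ∀ i, ∀ f ∈ W, (mulX F n i * pda F n a i) f + (Da F n a f + c • f) ∈ W := by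
    intro i f hf
    have := h2 i.castSucc (Fin.last n) f hf
    have h3 : (Pa F n a c i.castSucc i.castSucc - Pa F n a c (Fin.last n) (Fin.last n)) f =
        (mulX F n i * pda F n a i) f + (Da F n a f + c • f) := by
      simp [Pa]
      abel
    rwa [h3] at this
  have hD : ∀ f ∈ W, Da F n a f ∈ W := by
    intro f hf
    have h3 := W.sum_mem (fun i (_ : i ∈ Finset.univ) => hii i f hf)
    have h4 : ∑ i, (mulX F n i * pda F n a i) f = Da F n a f := by
      simp [Da, LinearMap.sum_apply]
    rw [Finset.sum_add_distrib, h4, Finset.sum_const, Finset.card_univ, Fintype.card_fin,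
      ← Nat.cast_smul_eq_nsmul F] at h3
    have h5 := W.sub_mem h3 (W.smul_mem ((n : F) * c) hf)
    have hn1 : ((n : F) + 1) ≠ 0 := by exact_mod_cast Nat.succ_ne_zero n
    have h6 := W.smul_mem ((n : F) + 1)⁻¹ h5
    convert h6 using 1
    rw [eq_inv_smul_iff₀ hn1]
    module
  have hx : ∀ i j, ∀ f ∈ W, X i * (pderiv j f + a j • f) ∈ W := by
    intro i j f hf
    by_cases hij : i = j
    · subst hij
      have := W.sub_mem (hii i f hf) (W.add_mem (hD f hf) (W.smul_mem c hf))
      simpa [mulX, pda] using this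
    · have := h1 i.castSucc j.castSucc (by simpa using hij) f hf
      simpa [Pa, mulX, pda] using this
  obtain ⟨j, hj⟩ := Function.ne_iff.mp ha
  have hmul : ∀ i, ∀ f ∈ W, X i * f ∈ W := fun i f hf =>
    aux_mul W (a j) hj i j (hd j) (hx i j) _ f (Nat.lt_succ_self _) hf
  obtain ⟨f, hf, hf0⟩ := W.ne_bot_iff.mp hW
  have hone := aux_one W hd _ f le_rfl hf hf0
  rw [eq_top_iff]
  intro p _
  induction p using MvPolynomial.induction_on with
  | C r => simpa [smul_eq_C_mul] using W.smul_mem r hone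
  | add p q hp hq => exact W.add_mem (hp trivial) (hq trivial)
  | mul_X p i hp => rw [mul_comm]; exact hmul i p (hp trivial)
end

section
/- Assume m ≥ 2 and 1 ≤ m1 ≤ m2 ≤ m. For k an integer let B_{⟨k⟩} = { f ∈ B : D̃_B(f) = k·f }. Each B_{⟨k⟩} is invariant under all operators Ex_{i,j} − Ey_{j,i}, Fo_{i,j} + Fo_{j,i}, Go_{i,j} + Go_{j,i} (i,j ∈ {1,…,m}). If moreover m1 < m2 or k ≠ 0, then the only F-linear subspaces of B_{⟨k⟩} invariant under all of these operators are {0} and B_{⟨k⟩}. -/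
open MvPolynomial

/-- The index set of the variables of `B = F[x_1,…,x_m,y_1,…,y_m]`:
`Sum.inl i` is `x_{i+1}` and `Sum.inr i` is `y_{i+1}` (`i : Fin m`). -/
abbrev BIdx (m : ℕ) := Fin m ⊕ Fin m

/-- Multiplication by `x_{i+1}`. -/
noncomputable def mxB (F : Type*) [Field F] (m : ℕ) (i : Fin m) :
    Module.End F (MvPolynomial (BIdx m) F) :=
  LinearMap.mulLeft F (X (Sum.inl i))

/-- Multiplication by `y_{i+1}`. -/
noncomputable def myB (F : Type*) [Field F] (m : ℕ) (i : Fin m) :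
    Module.End F (MvPolynomial (BIdx m) F) :=
  LinearMap.mulLeft F (X (Sum.inr i))

/-- The partial derivative `∂_{x_{i+1}}`. -/
noncomputable def dxB (F : Type*) [Field F] (m : ℕ) (i : Fin m) :
    Module.End F (MvPolynomial (BIdx m) F) :=
  (pderiv (Sum.inl i)).toLinearMap

/-- The partial derivative `∂_{y_{i+1}}`. -/
noncomputable def dyB (F : Type*) [Field F] (m : ℕ) (i : Fin m) :
    Module.End F (MvPolynomial (BIdx m) F) :=
  (pderiv (Sum.inr i)).toLinearMap

/-- The twisted Euler operator
`D̃_B = Σ_{r>m1} x_r∂_{x_r} − Σ_{i≤m1} x_i∂_{x_i} + Σ_{i≤m2} y_i∂_{y_i} − Σ_{r>m2} y_r∂_{y_r}`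
(a variable `i : Fin m` stands for the paper's index `i+1`). -/
noncomputable def DtB (F : Type*) [Field F] (m m1 m2 : ℕ) :
    Module.End F (MvPolynomial (BIdx m) F) :=
  (∑ i : Fin m,
    (if (i : ℕ) < m1 then -(mxB F m i * dxB F m i) else mxB F m i * dxB F m i)) +
  ∑ i : Fin m,
    (if (i : ℕ) < m2 then myB F m i * dyB F m i else -(myB F m i * dyB F m i))

/-- The operators `Ex_{i,j}` on `B`. -/
noncomputable def ExB (F : Type*) [Field F] (m m1 : ℕ) (i j : Fin m) :
    Module.End F (MvPolynomial (BIdx m) F) :=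
  if (i : ℕ) < m1 then
    if (j : ℕ) < m1 then
      -(mxB F m j * dxB F m i) - (if i = j then 1 else 0)
    else dxB F m i * dxB F m j
  else
    if (j : ℕ) < m1 then -(mxB F m i * mxB F m j)
    else mxB F m i * dxB F m j

/-- The operators `Ey_{i,j}` on `B`. -/
noncomputable def EyB (F : Type*) [Field F] (m m2 : ℕ) (i j : Fin m) :
    Module.End F (MvPolynomial (BIdx m) F) :=
  if (i : ℕ) < m2 then
    if (j : ℕ) < m2 then myB F m i * dyB F m j
    else -(myB F m i * myB F m j)
  else
    if (j : ℕ) < m2 then dyB F m i * dyB F m j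
    else -(myB F m j * dyB F m i) - (if i = j then 1 else 0)

/-- The operators `Fo_{i,j}` on `B`. -/
noncomputable def FoB (F : Type*) [Field F] (m m1 m2 : ℕ) (i j : Fin m) :
    Module.End F (MvPolynomial (BIdx m) F) :=
  if (i : ℕ) < m1 then
    if (j : ℕ) < m2 then dxB F m i * dyB F m j
    else -(myB F m j * dxB F m i)
  else
    if (j : ℕ) < m2 then mxB F m i * dyB F m j
    else -(mxB F m i * myB F m j)

/-- The operators `Go_{i,j}` on `B`. -/
noncomputable def GoB (F : Type*) [Field F] (m m1 m2 : ℕ) (i j : Fin m) :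
    Module.End F (MvPolynomial (BIdx m) F) :=
  if (j : ℕ) < m1 then
    if (i : ℕ) < m2 then -(mxB F m j * myB F m i)
    else -(mxB F m j * dyB F m i)
  else
    if (i : ℕ) < m2 then myB F m i * dxB F m j
    else dxB F m j * dyB F m i

/-- The operators spanning the image of the subalgebra `K ≅ sp(2m,F)` under the twisted
oscillator representation `π_{c,S}` on `B`. -/
noncomputable def KOpsT (F : Type*) [Field F] (m m1 m2 : ℕ) :
    Set (Module.End F (MvPolynomial (BIdx m) F)) :=
  {T | (∃ i j : Fin m, T = ExB F m m1 i j - EyB F m m2 j i) ∨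
       (∃ i j : Fin m, T = FoB F m m1 m2 i j + FoB F m m1 m2 j i) ∨
       (∃ i j : Fin m, T = GoB F m m1 m2 i j + GoB F m m1 m2 j i)}

/-- The eigenspace `B_{⟨k⟩} = {f ∈ B | D̃_B f = k·f}`. -/
noncomputable def Bgr (F : Type*) [Field F] (m m1 m2 : ℕ) (k : ℤ) :
    Submodule F (MvPolynomial (BIdx m) F) :=
  LinearMap.ker (DtB F m m1 m2 - (k : F) • 1)


section Gen
variable {F : Type*} [Field F] {σ : Type*} [DecidableEq σ]

/-- multiplication -/
noncomputable def opX (F : Type*) [Field F] {σ : Type*} (a : σ) :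
    Module.End F (MvPolynomial σ F) := LinearMap.mulLeft F (X a)

/-- derivative -/
noncomputable def opD (F : Type*) [Field F] {σ : Type*} (a : σ) :
    Module.End F (MvPolynomial σ F) := (pderiv a).toLinearMap

lemma opX_apply (a : σ) (f : MvPolynomial σ F) : opX F a f = X a * f := rfl
lemma opD_apply (a : σ) (f : MvPolynomial σ F) : opD F a f = pderiv a f := rfl

lemma end_neg_mul (A B : Module.End F (MvPolynomial σ F)) : (-A) * B = -(A * B) :=
  LinearMap.ext fun f => rfl
lemma end_mul_neg (A B : Module.End F (MvPolynomial σ F)) : A * (-B) = -(A * B) :=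
  LinearMap.ext fun f => map_neg A (B f)

/-- raising operator -/
noncomputable def opU (F : Type*) [Field F] {σ : Type*} (e : σ → Bool) (a : σ) :
    Module.End F (MvPolynomial σ F) :=
  if e a then opX F a else opD F a

/-- lowering operator -/
noncomputable def opL (F : Type*) [Field F] {σ : Type*} (e : σ → Bool) (a : σ) :
    Module.End F (MvPolynomial σ F) :=
  if e a then opD F a else -opX F a

lemma pd_mul (a b : σ) :
    (opD F a * opX F b : Module.End F (MvPolynomial σ F)) =
    opX F b * opD F a + if a = b then 1 else 0 := by
  refine LinearMap.ext fun f => ?_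
  by_cases h : a = b
  · subst h
    simp [opX_apply, opD_apply, add_comm]
  · have : (Pi.single a 1 : σ → MvPolynomial σ F) b = 0 := by
      rw [Pi.single_apply, if_neg (fun hh => h hh.symm)]
    simp [opX_apply, opD_apply, h, pderiv_X, this]

lemma pd_comm (a b : σ) :
    (opD F a * opD F b : Module.End F (MvPolynomial σ F)) =
    opD F b * opD F a := by
  classical
  refine MvPolynomial.linearMap_ext fun s => LinearMap.ext fun c => ?_
  simp only [LinearMap.comp_apply, Module.End.mul_apply, 
    opD_apply, pderiv_monomial]
  by_cases h : a = b
  · subst h; rfl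
  · have h1 : (s - ( Finsupp.single a 1 : σ →₀ ℕ)) b = s b := by simp [Finsupp.single_apply, h]
    have h2 : (s - ( Finsupp.single b 1 : σ →₀ ℕ)) a = s a := by
      simp [Finsupp.single_apply, show ¬ b = a from fun hh : b = a => h hh.symm]
    rw [h1, h2, tsub_right_comm]
    congr 1
    ring

lemma opLU (e : σ → Bool) (a b : σ) :
    opL F e a * opU F e b = opU F e b * opL F e a + if a = b then 1 else 0 := by
  have h1 := pd_mul (F := F) a b
  have h2 := pd_mul (F := F) b a
  have h3 := pd_comm (F := F) a b
  have h4 : (opX F a * opX F b :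
    Module.End F (MvPolynomial σ F)) = opX F b * opX F a := by
    refine LinearMap.ext fun f => ?_
    simp [opX_apply, mul_left_comm]
  by_cases hab : a = b
  · subst hab
    unfold opL opU
    cases e a
    · simp only [if_true] at h1
      simp [h1, end_neg_mul, end_mul_neg]
    · simpa using h1
  · simp only [hab, show ¬ b = a from fun hh : b = a => hab hh.symm, if_false, add_zero] at h1 h2 ⊢
    unfold opL opU
    cases e a <;> cases e b <;> simp [h1, h2, h3, h4, end_neg_mul, end_mul_neg]

lemma opUU (e : σ → Bool) (a b : σ) :
    opU F e a * opU F e b = opU F e b * opU F e a := by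
  by_cases hab : a = b
  · subst hab; rfl
  have h1 := pd_mul (F := F) a b
  have h2 := pd_mul (F := F) b a
  have h3 := pd_comm (F := F) a b
  have h4 : (opX F a * opX F b :
    Module.End F (MvPolynomial σ F)) = opX F b * opX F a := by
    refine LinearMap.ext fun f => ?_
    simp [opX_apply, mul_left_comm]
  simp only [hab, show ¬ b = a from fun hh : b = a => hab hh.symm, if_false, add_zero] at h1 h2 ⊢
  unfold opU
  cases e a <;> cases e b <;> simp [h1, h2, h3, h4, end_neg_mul, end_mul_neg]

lemma opLL (e : σ → Bool) (a b : σ) :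
    opL F e a * opL F e b = opL F e b * opL F e a := by
  by_cases hab : a = b
  · subst hab; rfl
  have h1 := pd_mul (F := F) a b
  have h2 := pd_mul (F := F) b a
  have h3 := pd_comm (F := F) a b
  have h4 : (opX F a * opX F b :
    Module.End F (MvPolynomial σ F)) = opX F b * opX F a := by
    refine LinearMap.ext fun f => ?_
    simp [opX_apply, mul_left_comm]
  simp only [hab, show ¬ b = a from fun hh : b = a => hab hh.symm, if_false, add_zero] at h1 h2 ⊢
  unfold opL
  cases e a <;> cases e b <;> simp [h1, h2, h3, h4, end_neg_mul, end_mul_neg]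

/-- eigenvalue of `U a * L a` -/
def eigN {σ : Type*} (e : σ → Bool) (a : σ) (s : σ →₀ ℕ) : ℤ :=
  if e a then (s a : ℤ) else -((s a : ℤ) + 1)

/-- exponent after raising -/
noncomputable def upE {σ : Type*} (e : σ → Bool) (a : σ) (s : σ →₀ ℕ) : σ →₀ ℕ :=
  if e a then s + Finsupp.single a 1 else s - Finsupp.single a 1

/-- exponent after lowering -/
noncomputable def dnE {σ : Type*} (e : σ → Bool) (a : σ) (s : σ →₀ ℕ) : σ →₀ ℕ :=
  if e a then s - Finsupp.single a 1 else s + Finsupp.single a 1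

lemma X_pd_mon (a : σ) (s : σ →₀ ℕ) (c : F) :
    X a * pderiv a (monomial s c) = monomial s ((s a : F) * c) := by
  classical
  rw [pderiv_monomial, mul_comm (X a), ← pow_one (X a), ← monomial_add_single]
  by_cases h : s a = 0
  · simp [h]
  · rw [tsub_add_cancel_of_le, mul_comm]
    rw [Finsupp.single_le_iff]; omega

lemma opUL_mon (e : σ → Bool) (a : σ) (s : σ →₀ ℕ) (c : F) :
    (opU F e a * opL F e a) (monomial s c) = monomial s ((eigN e a s : F) * c) := by
  unfold opU opL eigN
  cases h : e a
  · have h1 := congrArg (fun T : Module.End F (MvPolynomial σ F) => T (monomial s c))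
      (pd_mul (F := F) a a)
    simp only [Module.End.mul_apply, LinearMap.add_apply, opX_apply, if_true,
       opD_apply, Module.End.one_apply] at h1
    rw [X_pd_mon, ← map_add] at h1
    simp only [Module.End.mul_apply, LinearMap.neg_apply, opX_apply, if_false,
       opD_apply, map_neg, h1, Bool.false_eq_true]
    rw [← map_neg]
    congr 1
    push_cast; ring
  · simpa [opX_apply, opD_apply] using X_pd_mon a s c

lemma opU_mon (e : σ → Bool) (a : σ) (s : σ →₀ ℕ) (c : F) :
    opU F e a (monomial s c) = monomial (upE e a s) (c * if e a then 1 else (s a : F)) := by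
  classical
  unfold opU upE
  cases h : e a
  · simp [opD_apply, pderiv_monomial]
  · simp only [if_true, opX_apply, mul_one]
    rw [monomial_add_single, pow_one, mul_comm]

lemma opL_mon (e : σ → Bool) (a : σ) (s : σ →₀ ℕ) (c : F) :
    opL F e a (monomial s c) = monomial (dnE e a s) (c * if e a then (s a : F) else -1) := by
  classical
  unfold opL dnE
  cases h : e a
  · simp only [if_false, opX_apply, LinearMap.neg_apply, Bool.false_eq_true]
    rw [monomial_add_single, pow_one, mul_comm (X a : MvPolynomial σ F), mul_neg, mul_one, map_neg, neg_mul]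
  · simp [opD_apply, pderiv_monomial]

lemma diag_coeff (T : Module.End F (MvPolynomial σ F)) (l : (σ →₀ ℕ) → F)
    (h : ∀ s c, T (monomial s c) = monomial s (l s * c)) (s : σ →₀ ℕ) (f : MvPolynomial σ F) :
    coeff s (T f) = l s * coeff s f := by
  classical
  have : (lcoeff F s) ∘ₗ T = l s • lcoeff F s := by
    refine MvPolynomial.linearMap_ext fun t => LinearMap.ext fun c => ?_
    simp only [LinearMap.comp_apply, h, lcoeff_apply, LinearMap.smul_apply, coeff_monomial,
      smul_eq_mul]
    split_ifs with hh
    · rw [hh]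
    · simp
  simpa using congrArg (fun g => g f) this

/-- separation of monomials -/
lemma mon_mem (W : Submodule F (MvPolynomial σ F)) (Good : (σ →₀ ℕ) → Prop)
    (sep : ∀ s t, Good s → Good t → s ≠ t → ∃ (T : Module.End F (MvPolynomial σ F))
      (l : (σ →₀ ℕ) → F), (∀ f ∈ W, T f ∈ W) ∧
      (∀ s c, T (monomial s c) = monomial s (l s * c)) ∧ l s ≠ l t) :
    ∀ (n : ℕ) (f : MvPolynomial σ F), f ∈ W → f.support.card ≤ n → (∀ s ∈ f.support, Good s) →
      ∀ s ∈ f.support, monomial s (1 : F) ∈ W := by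
  classical
  intro n
  induction n with
  | zero =>
    intro f _ hc _ s hs
    have := Finset.card_pos.mpr ⟨s, hs⟩
    omega
  | succ n ih =>
    intro f hf hc hg s hs
    by_cases hex : ∃ t ∈ f.support, s ≠ t
    · obtain ⟨t, ht, hst⟩ := hex
      obtain ⟨T, l, hT, hl, hne⟩ := sep s t (hg s hs) (hg t ht) hst
      have hco : ∀ u, coeff u (T f - l t • f) = (l u - l t) * coeff u f := by
        intro u
        rw [coeff_sub, diag_coeff T l hl, coeff_smul, smul_eq_mul]; ring
      have hsub : (T f - l t • f).support ⊆ f.support.erase t := by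
        intro u hu
        rw [mem_support_iff, hco] at hu
        rw [Finset.mem_erase, mem_support_iff]
        refine ⟨?_, right_ne_zero_of_mul hu⟩
        rintro rfl
        simp at hu
      refine ih (T f - l t • f) (W.sub_mem (hT f hf) (W.smul_mem _ hf)) ?_ ?_ s ?_
      · have := Finset.card_le_card hsub
        rw [Finset.card_erase_of_mem ht] at this
        omega
      · intro u hu
        exact hg u (Finset.mem_of_mem_erase (hsub hu))
      · rw [mem_support_iff, hco]
        exact mul_ne_zero (sub_ne_zero.mpr hne) (mem_support_iff.mp hs)
    · push Not at hex
      have hfe : f = monomial s (coeff s f) := by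
        ext u
        rw [coeff_monomial]
        split_ifs with hh
        · rw [hh]
        · by_contra hu
          exact hh (hex u (mem_support_iff.mpr hu))
      have hc0 := mem_support_iff.mp hs
      have : monomial s (1 : F) = (coeff s f)⁻¹ • f := by
        conv_rhs => rw [hfe]
        rw [smul_monomial]
        simp [hc0]
      rw [this]
      exact W.smul_mem _ hf

end Gen

section Rng
variable {R : Type*} [Ring R]

lemma rng_diag1 (p q p' q' : R) (h1 : q' * q = q * q' + 1) (h2 : p' * q = q * p')
    (h3 : p' * q' = q' * p') :
    (p * q') * (q * p') = (p * p') * (q * q') + p * p' := by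
  calc (p * q') * (q * p') = p * (q' * q) * p' := by noncomm_ring
    _ = p * q * (q' * p') + p * p' := by rw [h1]; noncomm_ring
    _ = p * (q * p') * q' + p * p' := by rw [← h3]; noncomm_ring
    _ = _ := by rw [← h2]; noncomm_ring

/-- ring identity behind the Casimir-type elements -/
lemma rng_diag2 (p q p' q' r s r' s' : R)
    (hsp : s' * s = s * s' + 1) (hqp : q' * q = q * q' + 1)
    (hrr : r' * r = r * r' + 1)
    (c1 : s' * q = q * s') (c2 : s' * p' = p' * s') (c3 : s * p' = p' * s)
    (c4 : q' * r' = r' * q') (c5 : q * r' = r' * q) (c6 : r' * p' = p' * r') (c7 : r * p' = p' * r)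
    (c8 : q * p = p * q) (c9 : q' * s = s * q') (c10 : s * r = r * s) (c11 : q' * r = r * q')
    (c12 : q' * p' = p' * q') (c13 : r' * s' = s' * r') (c14 : q * s' = s' * q)
    (c15 : q * s = s * q) (c16 : q * r = r * q) (c17 : q' * s' = s' * q') :
    (p * s' + r * q') * (q * r' + s * p') + (p * r' - s * q') * (r * p' - q * s') =
      (p * p' + q * q') * (r * r' + s * s') + (p * p' + p * p') + r * r' + s * s' := by
  have e1 : (p * s') * (q * r') = (p * r') * (q * s') := by
    calc (p * s') * (q * r') = p * (s' * q) * r' := by noncomm_ring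
      _ = p * q * (s' * r') := by rw [c1]; noncomm_ring
      _ = p * (q * r') * s' := by rw [← c13]; noncomm_ring
      _ = _ := by rw [c5]; noncomm_ring
  have e2 : (r * q') * (s * p') = (s * q') * (r * p') := by
    calc (r * q') * (s * p') = r * (q' * s) * p' := by noncomm_ring
      _ = (r * s) * q' * p' := by rw [c9]; noncomm_ring
      _ = s * (r * q') * p' := by rw [← c10]; noncomm_ring
      _ = _ := by rw [← c11]; noncomm_ring
  have e3 : (p * s') * (s * p') = (p * p') * (s * s') + p * p' := by
    calc (p * s') * (s * p') = p * (s' * s) * p' := by noncomm_ring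
      _ = p * s * (s' * p') + p * p' := by rw [hsp]; noncomm_ring
      _ = p * (s * p') * s' + p * p' := by rw [c2]; noncomm_ring
      _ = _ := by rw [c3]; noncomm_ring
  have e4 : (r * q') * (q * r') = (q * q') * (r * r') + r * r' := by
    calc (r * q') * (q * r') = r * (q' * q) * r' := by noncomm_ring
      _ = r * q * (q' * r') + r * r' := by rw [hqp]; noncomm_ring
      _ = r * (q * r') * q' + r * r' := by rw [c4]; noncomm_ring
      _ = r * r' * (q * q') + r * r' := by rw [c5]; noncomm_ring
      _ = _ := by
        rw [((show Commute q r from c16).mul_left (show Commute q' r from c11)).mul_right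
          ((show Commute q r' from c5).mul_left (show Commute q' r' from c4))]
  have e5 : (p * r') * (r * p') = (p * p') * (r * r') + p * p' := by
    calc (p * r') * (r * p') = p * (r' * r) * p' := by noncomm_ring
      _ = p * r * (r' * p') + p * p' := by rw [hrr]; noncomm_ring
      _ = p * (r * p') * r' + p * p' := by rw [c6]; noncomm_ring
      _ = _ := by rw [c7]; noncomm_ring
  have e6 : (s * q') * (q * s') = (q * q') * (s * s') + s * s' := by
    calc (s * q') * (q * s') = s * (q' * q) * s' := by noncomm_ring
      _ = s * q * (q' * s') + s * s' := by rw [hqp]; noncomm_ring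
      _ = s * (q * s') * q' + s * s' := by rw [c17]; noncomm_ring
      _ = s * s' * (q * q') + s * s' := by rw [c14]; noncomm_ring
      _ = _ := by
        rw [((show Commute q s from c15).mul_left (show Commute q' s from c9)).mul_right
          ((show Commute q s' from c14).mul_left (show Commute q' s' from c17))]
  linear_combination (norm := noncomm_ring) e1 + e2 + e3 + e4 + e5 + e6

end Rng

section Part2
variable {F : Type*} [Field F] {m : ℕ}

/-- sign of a variable -/
def eSgn (m m1 m2 : ℕ) : BIdx m → Bool :=
  Sum.elim (fun i => !decide ((i : ℕ) < m1)) (fun i => decide ((i : ℕ) < m2))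

lemma mxB_eq (i : Fin m) : mxB F m i = opX F (Sum.inl i) := rfl
lemma myB_eq (i : Fin m) : myB F m i = opX F (Sum.inr i) := rfl
lemma dxB_eq (i : Fin m) : dxB F m i = opD F (Sum.inl i) := rfl
lemma dyB_eq (i : Fin m) : dyB F m i = opD F (Sum.inr i) := rfl

lemma opXX (a b : BIdx m) : opX F a * opX F b = opX F b * opX F a := by
  refine LinearMap.ext fun f => ?_
  simp [opX_apply, mul_left_comm]

lemma ExB_eq (m1 m2 : ℕ) (i j : Fin m) : ExB F m m1 i j =
    opU F (eSgn m m1 m2) (Sum.inl i) * opL F (eSgn m m1 m2) (Sum.inl j) := by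
  unfold ExB opU opL eSgn
  simp only [mxB_eq, dxB_eq, Sum.elim_inl]
  by_cases hi : (i : ℕ) < m1 <;> by_cases hj : (j : ℕ) < m1 <;>
    simp [hi, hj, end_mul_neg, pd_mul, sub_eq_add_neg, add_comm]

lemma EyB_eq (m1 m2 : ℕ) (i j : Fin m) : EyB F m m2 i j =
    opU F (eSgn m m1 m2) (Sum.inr i) * opL F (eSgn m m1 m2) (Sum.inr j) := by
  unfold EyB opU opL eSgn
  simp only [myB_eq, dyB_eq, Sum.elim_inr]
  by_cases hi : (i : ℕ) < m2 <;> by_cases hj : (j : ℕ) < m2 <;>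
    simp [hi, hj, end_mul_neg, pd_mul, sub_eq_add_neg, add_comm]

lemma FoB_eq (m1 m2 : ℕ) (i j : Fin m) : FoB F m m1 m2 i j =
    opU F (eSgn m m1 m2) (Sum.inl i) * opL F (eSgn m m1 m2) (Sum.inr j) := by
  unfold FoB opU opL eSgn
  simp only [myB_eq, dyB_eq, mxB_eq, dxB_eq, Sum.elim_inr, Sum.elim_inl]
  by_cases hi : (i : ℕ) < m1 <;> by_cases hj : (j : ℕ) < m2 <;>
    simp [hi, hj, end_mul_neg, pd_mul]

lemma GoB_eq (m1 m2 : ℕ) (i j : Fin m) : GoB F m m1 m2 i j =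
    opU F (eSgn m m1 m2) (Sum.inr i) * opL F (eSgn m m1 m2) (Sum.inl j) := by
  unfold GoB opU opL eSgn
  simp only [myB_eq, dyB_eq, mxB_eq, dxB_eq, Sum.elim_inr, Sum.elim_inl]
  by_cases hi : (i : ℕ) < m2 <;> by_cases hj : (j : ℕ) < m1 <;>
    simp [hi, hj, end_mul_neg, pd_mul]
  · rw [opXX]
  · rw [pd_comm]

/-- degree -/
def degE {σ : Type*} [Fintype σ] (e : σ → Bool) (s : σ →₀ ℕ) : ℤ :=
  ∑ a, if e a then (s a : ℤ) else -(s a : ℤ)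

lemma DtB_eq (m1 m2 : ℕ) : DtB F m m1 m2 =
    ∑ a : BIdx m, if eSgn m m1 m2 a then opX F a * opD F a else -(opX F a * opD F a) := by
  rw [Fintype.sum_sum_type]
  unfold DtB eSgn
  simp only [myB_eq, dyB_eq, mxB_eq, dxB_eq, Sum.elim_inr, Sum.elim_inl]
  congr 1
  · refine Finset.sum_congr rfl fun i _ => ?_
    by_cases hi : (i : ℕ) < m1 <;> simp [hi]
  · refine Finset.sum_congr rfl fun i _ => ?_
    by_cases hi : (i : ℕ) < m2 <;> simp [hi]

lemma DtB_mon (m1 m2 : ℕ) (s : BIdx m →₀ ℕ) (c : F) : DtB F m m1 m2 (monomial s c) =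
    monomial s ((degE (eSgn m m1 m2) s : F) * c) := by
  rw [DtB_eq, LinearMap.sum_apply, degE, Int.cast_sum, Finset.sum_mul, map_sum]
  refine Finset.sum_congr rfl fun a _ => ?_
  split_ifs
  · rw [Module.End.mul_apply, opX_apply, opD_apply, X_pd_mon, Int.cast_natCast]
  · rw [LinearMap.neg_apply, Module.End.mul_apply, opX_apply, opD_apply, X_pd_mon, ← map_neg,
      Int.cast_neg, Int.cast_natCast, neg_mul]

lemma mem_Bgr [CharZero F] (m1 m2 : ℕ) (k : ℤ) (f : MvPolynomial (BIdx m) F) :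
    f ∈ Bgr F m m1 m2 k ↔ ∀ s ∈ f.support, degE (eSgn m m1 m2) s = k := by
  have hco := diag_coeff (DtB F m m1 m2) (fun s => (degE (eSgn m m1 m2) s : F)) (DtB_mon m1 m2)
  have : f ∈ Bgr F m m1 m2 k ↔ DtB F m m1 m2 f = (k : F) • f := by
    unfold Bgr
    rw [LinearMap.mem_ker, LinearMap.sub_apply, sub_eq_zero]
    rfl
  rw [this, MvPolynomial.ext_iff]
  refine forall_congr' fun s => ?_
  rw [hco, coeff_smul, smul_eq_mul, mem_support_iff]
  constructor
  · intro h hne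
    exact_mod_cast mul_right_cancel₀ hne h
  · intro h
    by_cases hc : coeff s f = 0
    · simp [hc]
    · rw [h hc]

lemma DtB_eul (m1 m2 : ℕ) : ∃ c : F, DtB F m m1 m2 =
    (∑ a : BIdx m, opU F (eSgn m m1 m2) a * opL F (eSgn m m1 m2) a) + c • 1 := by
  refine ⟨∑ a : BIdx m, if eSgn m m1 m2 a then 0 else 1, ?_⟩
  rw [DtB_eq, Finset.sum_smul, ← Finset.sum_add_distrib]
  refine Finset.sum_congr rfl fun a _ => ?_
  unfold opU opL
  split_ifs
  · simp
  · simp [end_mul_neg, pd_mul]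

lemma eul_U {σ : Type*} [Fintype σ] [DecidableEq σ] (e : σ → Bool) (p : σ) :
    (∑ a, opU F e a * opL F e a) * opU F e p =
      opU F e p * (∑ a, opU F e a * opL F e a) + opU F e p := by
  have : ∀ a, opU F e a * opL F e a * opU F e p =
      opU F e p * (opU F e a * opL F e a) + if a = p then opU F e a else 0 := by
    intro a
    rw [mul_assoc, opLU, mul_add, ← mul_assoc, opUU, mul_assoc]
    split_ifs <;> simp
  rw [Finset.sum_mul, Finset.sum_congr rfl fun a _ => this a, Finset.sum_add_distrib,
    Finset.mul_sum]
  simp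

lemma eul_L {σ : Type*} [Fintype σ] [DecidableEq σ] (e : σ → Bool) (p : σ) :
    (∑ a, opU F e a * opL F e a) * opL F e p + opL F e p =
      opL F e p * (∑ a, opU F e a * opL F e a) := by
  have : ∀ a, opL F e p * (opU F e a * opL F e a) = 
      (opU F e a * opL F e a) * opL F e p + if p = a then opL F e a else 0 := by
    intro a
    rw [← mul_assoc, opLU, add_mul, mul_assoc, opLL, mul_assoc]
    split_ifs <;> simp
  rw [Finset.mul_sum, Finset.sum_congr rfl fun a _ => this a, Finset.sum_add_distrib,
    Finset.sum_mul]
  simp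

lemma DtB_comm (m1 m2 : ℕ) (p q : BIdx m) :
    Commute (DtB F m m1 m2) (opU F (eSgn m m1 m2) p * opL F (eSgn m m1 m2) q) := by
  obtain ⟨c, hc⟩ := DtB_eul (F := F) (m := m) m1 m2
  have h1 := eul_U (F := F) (eSgn m m1 m2) p
  have h2 := eul_L (F := F) (eSgn m m1 m2) q
  rw [hc]
  refine Commute.add_left ?_ ((Commute.one_left _).smul_left c)
  unfold Commute SemiconjBy
  rw [← mul_assoc, h1, add_mul, mul_assoc, mul_assoc, ← h2, mul_add]

lemma DtB_comm' (m1 m2 : ℕ) (T : Module.End F (MvPolynomial (BIdx m) F))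
    (hT : T ∈ KOpsT F m m1 m2) : Commute (DtB F m m1 m2) T := by
  rcases hT with ⟨i, j, rfl⟩ | ⟨i, j, rfl⟩ | ⟨i, j, rfl⟩
  · rw [ExB_eq m1 m2, EyB_eq m1 m2]
    exact (DtB_comm _ _ _ _).sub_right (DtB_comm _ _ _ _)
  · rw [FoB_eq m1 m2, FoB_eq m1 m2]
    exact (DtB_comm _ _ _ _).add_right (DtB_comm _ _ _ _)
  · rw [GoB_eq m1 m2, GoB_eq m1 m2]
    exact (DtB_comm _ _ _ _).add_right (DtB_comm _ _ _ _)

lemma part_one (m1 m2 : ℕ) (k : ℤ) (T : Module.End F (MvPolynomial (BIdx m) F))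
    (hT : T ∈ KOpsT F m m1 m2) (f : MvPolynomial (BIdx m) F) (hf : f ∈ Bgr F m m1 m2 k) :
    T f ∈ Bgr F m m1 m2 k := by
  have key : ∀ f, f ∈ Bgr F m m1 m2 k ↔ DtB F m m1 m2 f = (k : F) • f := by
    intro f
    unfold Bgr
    rw [LinearMap.mem_ker, LinearMap.sub_apply, sub_eq_zero]
    rfl
  rw [key] at hf ⊢
  have h : DtB F m m1 m2 (T f) = T (DtB F m m1 m2 f) :=
    congrArg (fun A : Module.End F (MvPolynomial (BIdx m) F) => A f) (DtB_comm' m1 m2 T hT)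
  rw [h, hf, map_smul]

lemma int_sep (n n' u u' : Fin m → ℤ) (h1 : ∀ i, n i - u i = n' i - u' i)
    (h2 : ∀ i, n i * u i + n i = n' i * u' i + n' i)
    (h3 : ∀ i j, i ≠ j → (n i + u i) * (n j + u j) + (n i + n i) + n j + u j =
      (n' i + u' i) * (n' j + u' j) + (n' i + n' i) + n' j + u' j)
    (h4 : ∑ i, (n i + u i + 1) = ∑ i, (n' i + u' i + 1))
    (h5 : (∃ i, 0 ≤ n i ∧ 0 ≤ u i ∧ 0 ≤ n' i ∧ 0 ≤ u' i) ∨ ∑ i, (n i + u i + 1) ≠ 0) :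
    ∀ i, n i = n' i ∧ u i = u' i := by
  have hp : ∀ i j, (n i + u i + 1) * (n j + u j + 1) = (n' i + u' i + 1) * (n' j + u' j + 1) := by
    intro i j
    by_cases hij : i = j
    · subst hij
      have a := h1 i
      have b := h2 i
      have c : (n i - u i) ^ 2 = (n' i - u' i) ^ 2 := by rw [a]
      linear_combination c + 4 * b - 2 * a
    · have a := h1 i
      have b := h3 i j hij
      linear_combination b - a
  have hs : ∀ j, n j + u j + 1 = n' j + u' j + 1 := by
    rcases h5 with ⟨i, b1, b2, b3, b4⟩ | h5
    · have e : n i + u i + 1 = n' i + u' i + 1 := by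
        have := hp i i
        nlinarith
      intro j
      have := hp i j
      rw [← e] at this
      exact mul_left_cancel₀ (by omega) this
    · intro j
      have : (∑ i, (n i + u i + 1)) * (n j + u j + 1) =
          (∑ i, (n i + u i + 1)) * (n' j + u' j + 1) := by
        conv_rhs => rw [h4]
        rw [Finset.sum_mul, Finset.sum_mul]
        exact Finset.sum_congr rfl fun i _ => hp i j
      exact mul_left_cancel₀ h5 this
  intro i
  have := hs i
  have := h1 i
  omega

/-- the separation statement -/
lemma sep_lemma [CharZero F] (m1 m2 : ℕ) (h12 : m1 ≤ m2) (h2m : m2 ≤ m) (k : ℤ)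
    (hk : m1 < m2 ∨ k ≠ 0)
    (W : Submodule F (MvPolynomial (BIdx m) F))
    (hW : ∀ T ∈ KOpsT F m m1 m2, ∀ f ∈ W, T f ∈ W) (s t : BIdx m →₀ ℕ)
    (hs : degE (eSgn m m1 m2) s = k) (ht : degE (eSgn m m1 m2) t = k) (hst : s ≠ t) :
    ∃ (T : Module.End F (MvPolynomial (BIdx m) F))
      (l : (BIdx m →₀ ℕ) → F), (∀ f ∈ W, T f ∈ W) ∧
      (∀ s c, T (monomial s c) = monomial s (l s * c)) ∧ l s ≠ l t := by
  by_contra hno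
  push Not at hno
  apply hst
  set e := eSgn m m1 m2 with he
  have hUL := opUL_mon (F := F) e
  have key := int_sep (fun i => eigN e (Sum.inl i) s) (fun i => eigN e (Sum.inl i) t)
    (fun i => eigN e (Sum.inr i) s) (fun i => eigN e (Sum.inr i) t) ?_ ?_ ?_ ?_ ?_
  · ext a
    rcases a with i | i
    · have := (key i).1
      simp only [eigN] at this
      split_ifs at this <;> omega
    · have := (key i).2
      simp only [eigN] at this
      split_ifs at this <;> omega
  · intro i
    have := hno (ExB F m m1 i i - EyB F m m2 i i)
      (fun s => (eigN e (Sum.inl i) s : F) - (eigN e (Sum.inr i) s : F))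
      (hW _ (Or.inl ⟨i, i, rfl⟩)) ?_
    · exact_mod_cast this
    · intro s c
      rw [ExB_eq m1 m2, EyB_eq m1 m2, LinearMap.sub_apply, ← he, hUL, hUL, ← map_sub, sub_mul]
  · intro i
    have := hno ((FoB F m m1 m2 i i + FoB F m m1 m2 i i) * (GoB F m m1 m2 i i + GoB F m m1 m2 i i))
      (fun s => 4 * ((eigN e (Sum.inl i) s : F) * (eigN e (Sum.inr i) s : F) + eigN e (Sum.inl i) s))
      (fun f hf => hW _ (Or.inr (Or.inl ⟨i, i, rfl⟩)) _ 
        (hW _ (Or.inr (Or.inr ⟨i, i, rfl⟩)) f hf)) ?_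
    · have := mul_left_cancel₀ (by norm_num) this
      exact_mod_cast this
    · intro s c
      have hr := rng_diag1 (opU F e (Sum.inl i)) (opU F e (Sum.inr i)) (opL F e (Sum.inl i))
        (opL F e (Sum.inr i)) (by simp [opLU]) (by simp [opLU]) (opLL _ _ _)
      rw [FoB_eq m1 m2, GoB_eq m1 m2, ← he, add_mul, mul_add, hr]
      simp only [LinearMap.add_apply, Module.End.mul_apply (opU F e _ * opL F e _), hUL, ← map_add]
      congr 1
      ring
  · intro i j hij
    have := hno ((FoB F m m1 m2 i j + FoB F m m1 m2 j i) * (GoB F m m1 m2 i j + GoB F m m1 m2 j i)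
      + (ExB F m m1 i j - EyB F m m2 j i) * (ExB F m m1 j i - EyB F m m2 i j))
      (fun s => ((eigN e (Sum.inl i) s : F) + (eigN e (Sum.inr i) s : F)) *
        ((eigN e (Sum.inl j) s : F) + (eigN e (Sum.inr j) s : F)) + 
        ((eigN e (Sum.inl i) s : F) + eigN e (Sum.inl i) s) + eigN e (Sum.inl j) s
        + eigN e (Sum.inr j) s)
      (fun f hf => W.add_mem (hW _ (Or.inr (Or.inl ⟨i, j, rfl⟩)) _ 
        (hW _ (Or.inr (Or.inr ⟨i, j, rfl⟩)) f hf))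
        (hW _ (Or.inl ⟨i, j, rfl⟩) _ (hW _ (Or.inl ⟨j, i, rfl⟩) f hf))) ?_
    · exact_mod_cast this
    · intro s c
      have hji : ¬ j = i := fun h => hij h.symm
      have hr := rng_diag2 (opU F e (Sum.inl i)) (opU F e (Sum.inr i)) (opL F e (Sum.inl i))
        (opL F e (Sum.inr i)) (opU F e (Sum.inl j)) (opU F e (Sum.inr j)) (opL F e (Sum.inl j))
        (opL F e (Sum.inr j)) (by simp [opLU]) (by simp [opLU]) (by simp [opLU])
        (by simp [opLU, hij, hji]) (opLL _ _ _) (by simp [opLU, hij, hji])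
        (opLL _ _ _) (by simp [opLU, hij, hji]) (opLL _ _ _) (by simp [opLU, hij, hji])
        (opUU _ _ _) (by simp [opLU, hij, hji]) (opUU _ _ _) (by simp [opLU, hij, hji])
        (opLL _ _ _) (opLL _ _ _) (by simp [opLU, hij, hji]) (opUU _ _ _) (opUU _ _ _)
        (opLL _ _ _)
      rw [FoB_eq m1 m2, GoB_eq m1 m2, FoB_eq m1 m2, GoB_eq m1 m2, ExB_eq m1 m2, EyB_eq m1 m2,
        ExB_eq m1 m2, EyB_eq m1 m2, ← he, hr]
      simp only [LinearMap.add_apply, Module.End.mul_apply (opU F e _ * opL F e _ + _),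
        hUL, ← map_add]
      congr 1
      ring
  · have h := hs.trans ht.symm
    simp only [degE, Fintype.sum_sum_type, ← Finset.sum_add_distrib] at h
    rw [← sub_eq_zero, ← Finset.sum_sub_distrib] at h ⊢
    rw [← h]
    refine Finset.sum_congr rfl fun i _ => ?_
    simp only [eigN]
    split_ifs <;> ring
  · by_cases hlt : m1 < m2
    · left
      refine ⟨⟨m1, by omega⟩, ?_⟩
      simp [eigN, he, eSgn, hlt]
    · right
      have hk0 : k ≠ 0 := by tauto
      have hmm : m1 = m2 := by omega
      subst hmm
      rw [← hs] at hk0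
      simp only [degE, Fintype.sum_sum_type, ← Finset.sum_add_distrib] at hk0
      intro h0
      apply hk0
      rw [← h0]
      refine Finset.sum_congr rfl fun i _ => ?_
      by_cases hi : (i : ℕ) < m1 <;> simp [eigN, he, eSgn, hi] <;> ring

lemma move_op (m1 m2 : ℕ) (p q : BIdx m) (hpq : p ≠ q) : ∃ (a b : ℤ) (p2 q2 : BIdx m),
    a ≠ 0 ∧ (b = 0 ∨ (p ≠ p2 ∧ p ≠ q2)) ∧ ∃ T ∈ KOpsT F m m1 m2, ∀ f, T f =
      (a : F) • (opU F (eSgn m m1 m2) p * opL F (eSgn m m1 m2) q) f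
      + (b : F) • (opU F (eSgn m m1 m2) p2 * opL F (eSgn m m1 m2) q2) f := by
  rcases p with i | i <;> rcases q with j | j
  · have hij : i ≠ j := fun h => hpq (by rw [h])
    refine ⟨1, -1, Sum.inr j, Sum.inr i, by simp, Or.inr (by simp), _,
      Or.inl ⟨i, j, rfl⟩, fun f => ?_⟩
    rw [ExB_eq m1 m2, EyB_eq m1 m2]; simp [sub_eq_add_neg]
  · by_cases hij : i = j
    · subst hij
      refine ⟨2, 0, Sum.inl i, Sum.inr i, by simp, Or.inl rfl, _,
        Or.inr (Or.inl ⟨i, i, rfl⟩), fun f => ?_⟩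
      rw [FoB_eq m1 m2]; simp [two_smul]
    · refine ⟨1, 1, Sum.inl j, Sum.inr i, by simp, Or.inr (by simp [hij]), _,
        Or.inr (Or.inl ⟨i, j, rfl⟩), fun f => ?_⟩
      rw [FoB_eq m1 m2, FoB_eq m1 m2]; simp
  · by_cases hij : i = j
    · subst hij
      refine ⟨2, 0, Sum.inl i, Sum.inr i, by simp, Or.inl rfl, _,
        Or.inr (Or.inr ⟨i, i, rfl⟩), fun f => ?_⟩
      rw [GoB_eq m1 m2]; simp [two_smul]
    · refine ⟨1, 1, Sum.inr j, Sum.inl i, by simp, Or.inr (by simp [hij]), _,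
        Or.inr (Or.inr ⟨i, j, rfl⟩), fun f => ?_⟩
      rw [GoB_eq m1 m2, GoB_eq m1 m2]; simp
  · have hij : i ≠ j := fun h => hpq (by rw [h])
    refine ⟨-1, 1, Sum.inl j, Sum.inl i, by simp, Or.inr (by simp), _,
      Or.inl ⟨j, i, rfl⟩, fun f => ?_⟩
    rw [ExB_eq m1 m2, EyB_eq m1 m2]; simp [sub_eq_add_neg, add_comm]

lemma upE_apply {σ : Type*} [DecidableEq σ] (e : σ → Bool) (a : σ) (s : σ →₀ ℕ) (b : σ) :
    upE e a s b = if a = b then (if e a then s b + 1 else s b - 1) else s b := by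
  unfold upE
  split_ifs <;> simp_all [Finsupp.single_apply]

lemma dnE_apply {σ : Type*} [DecidableEq σ] (e : σ → Bool) (a : σ) (s : σ →₀ ℕ) (b : σ) :
    dnE e a s b = if a = b then (if e a then s b - 1 else s b + 1) else s b := by
  unfold dnE
  split_ifs <;> simp_all [Finsupp.single_apply]

lemma part_two [CharZero F] (m1 m2 : ℕ) (h12 : m1 ≤ m2) (h2m : m2 ≤ m) (k : ℤ)
    (hk : m1 < m2 ∨ k ≠ 0)
    (W : Submodule F (MvPolynomial (BIdx m) F)) (hWB : W ≤ Bgr F m m1 m2 k)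
    (hW : ∀ T ∈ KOpsT F m m1 m2, ∀ f ∈ W, T f ∈ W) : W = ⊥ ∨ W = Bgr F m m1 m2 k := by
  by_cases hbot : W = ⊥
  · exact Or.inl hbot
  right
  refine le_antisymm hWB ?_
  set e := eSgn m m1 m2 with he
  have hmon : ∀ f ∈ W, ∀ s ∈ f.support, monomial s (1 : F) ∈ W := fun f hf =>
    mon_mem W (fun s => degE e s = k) (sep_lemma m1 m2 h12 h2m k hk W hW) _ f hf le_rfl
      ((mem_Bgr m1 m2 k f).mp (hWB hf))
  have hdeg : ∀ s, monomial s (1 : F) ∈ W → degE e s = k := fun s hs =>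
    (mem_Bgr m1 m2 k _).mp (hWB hs) s (by simp)
  have hmove : ∀ p q, p ≠ q → ∀ s, monomial s (1 : F) ∈ W → (e p = false → s p ≠ 0) →
      (e q = true → s q ≠ 0) → monomial (upE e p (dnE e q s)) (1 : F) ∈ W := by
    intro p q hpq s hs hp hq
    obtain ⟨a, b, p2, q2, ha, hb, T, hT, hTf⟩ := move_op (F := F) m1 m2 p q hpq
    refine hmon _ (hW T hT _ hs) _ ?_
    rw [mem_support_iff, hTf, ← he]
    simp only [Module.End.mul_apply, opL_mon, opU_mon, coeff_add, coeff_smul, coeff_monomial,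
      if_true, smul_eq_mul]
    have hne : b = 0 ∨ ¬ (upE e p2 (dnE e q2 s) = upE e p (dnE e q s)) := by
      refine hb.imp id fun h heq => ?_
      have := DFunLike.congr_fun heq p
      simp only [upE_apply, dnE_apply, if_neg h.1.symm, if_neg h.2.symm, if_neg hpq.symm,
        if_true] at this
      cases hep : e p
      · have := hp hep
        simp [hep] at *
        omega
      · simp [hep] at this
    have hz : (b : F) * (if upE e p2 (dnE e q2 s) = upE e p (dnE e q s) then
       1 * (if e q2 then (s q2 : F) else -1) * (if e p2 then 1 else (dnE e q2 s p2 : F)) else 0) = 0 := by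
      rcases hne with h | h
      · simp [h]
      · rw [if_neg h, mul_zero]
    rw [hz, add_zero]
    refine mul_ne_zero (by exact_mod_cast ha) (mul_ne_zero (mul_ne_zero one_ne_zero ?_) ?_)
    · split_ifs with h
      · exact_mod_cast hq h
      · simp
    · split_ifs with h
      · simp
      · rw [dnE_apply, if_neg hpq.symm]
        exact_mod_cast hp (by simpa using h)
  have hconn : ∀ (n : ℕ) (s t : BIdx m →₀ ℕ), monomial s (1 : F) ∈ W → degE e t = k →
      ∑ a, ((s a : ℤ) - t a).natAbs ≤ n → monomial t (1 : F) ∈ W := by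
    intro n
    induction n with
    | zero =>
      intro s t hs ht hn
      have : s = t := by
        ext a
        have := Finset.sum_eq_zero_iff.mp (Nat.le_zero.mp hn) a (Finset.mem_univ a)
        omega
      rwa [← this]
    | succ n ih =>
      intro s t hs ht hn
      by_cases hst : s = t
      · rwa [← hst]
      have hsum : ∑ a, (if e a then ((t a : ℤ) - s a) else -((t a : ℤ) - s a)) = 0 := by
        have := ht.trans (hdeg s hs).symm
        rw [← sub_eq_zero] at this
        rw [← this, degE, degE, ← Finset.sum_sub_distrib]
        refine Finset.sum_congr rfl fun a _ => ?_
        split_ifs <;> ring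
      obtain ⟨b, hb⟩ : ∃ b, s b ≠ t b := by
        by_contra hcon
        push Not at hcon
        exact hst (Finsupp.ext hcon)
      obtain ⟨p, -, hp⟩ := Finset.exists_pos_of_sum_zero_of_exists_nonzero _ hsum
        ⟨b, Finset.mem_univ b, by split_ifs <;> omega⟩
      obtain ⟨q, -, hq⟩ := Finset.exists_pos_of_sum_zero_of_exists_nonzero 
        (fun a => -(if e a then ((t a : ℤ) - s a) else -((t a : ℤ) - s a)))
        (by rw [Finset.sum_neg_distrib, hsum, neg_zero])
        ⟨b, Finset.mem_univ b, by split_ifs <;> omega⟩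
      have hpq : p ≠ q := by
        rintro rfl
        omega
      refine ih (upE e p (dnE e q s)) t (hmove p q hpq s hs ?_ ?_) ht ?_
      · intro h
        simp [h] at hp
        omega
      · intro h
        simp [h] at hq
        omega
      · refine Nat.le_of_lt_succ (lt_of_lt_of_le (Finset.sum_lt_sum (fun a _ => ?_)
          ⟨p, Finset.mem_univ p, ?_⟩) hn)
        · rw [upE_apply, dnE_apply]
          by_cases h1 : p = a
          · subst h1
            rw [if_pos rfl, if_neg hpq.symm]
            split_ifs at hp ⊢ <;> omega
          · rw [if_neg h1]
            by_cases h2 : q = a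
            · subst h2
              rw [if_pos rfl]
              split_ifs at hq ⊢ <;> omega
            · rw [if_neg h2]
        · rw [upE_apply, dnE_apply, if_pos rfl, if_neg hpq.symm]
          split_ifs at hp ⊢ <;> omega
  obtain ⟨f, hf, hf0⟩ := (Submodule.ne_bot_iff W).mp hbot
  obtain ⟨s, hs⟩ := Finset.nonempty_iff_ne_empty.mpr (fun h => hf0 (support_eq_empty.mp h))
  have hsW := hmon f hf s hs
  intro g hg
  rw [mem_Bgr] at hg
  rw [g.as_sum]
  refine W.sum_mem fun t ht => ?_
  have := W.smul_mem (coeff t g) (hconn _ s t hsW (hg t ht) le_rfl)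
  rwa [smul_monomial, smul_eq_mul, mul_one] at this

end Part2

/-- each `B_{⟨k⟩}` is invariant under all the operators of `K`, and when
`m1 < m2` or `k ≠ 0` it has no nontrivial invariant subspaces. -/
theorem stmt_18 (F : Type*) [Field F] [CharZero F] (m m1 m2 : ℕ) (hm : 2 ≤ m)
    (hm1 : 1 ≤ m1) (h12 : m1 ≤ m2) (h2m : m2 ≤ m) (k : ℤ) :
    (∀ T ∈ KOpsT F m m1 m2, ∀ f ∈ Bgr F m m1 m2 k, T f ∈ Bgr F m m1 m2 k) ∧
    (m1 < m2 ∨ k ≠ 0 →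
      ∀ W : Submodule F (MvPolynomial (BIdx m) F), W ≤ Bgr F m m1 m2 k →
        (∀ T ∈ KOpsT F m m1 m2, ∀ f ∈ W, T f ∈ W) →
        W = ⊥ ∨ W = Bgr F m m1 m2 k) := by
  exact ⟨fun T hT f hf => part_one m1 m2 k T hT f hf,
    fun hk W hWB hW => part_two m1 m2 h12 h2m k hk W hWB hW⟩
end

section
/- Assume m ≥ 2 and 1 ≤ m1 = m2 ≤ m. Then B_{⟨0⟩} = { f ∈ B : D̃_B(f) = 0 } is the direct sum of two nonzero F-linear subspaces V_1 and V_2, each invariant under all operators Ex_{i,j} − Ey_{j,i}, Fo_{i,j} + Fo_{j,i}, Go_{i,j} + Go_{j,i} (i,j ∈ {1,…,m}), and such that the only invariant subspaces of V_1 are {0} and V_1 and the only invariant subspaces of V_2 are {0} and V_2. -/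
open MvPolynomial

namespace Osc

variable {F : Type*} [Field F] {m : ℕ} (m1 : ℕ)

def uI (i : Fin m) : BIdx m := if (i : ℕ) < m1 then Sum.inr i else Sum.inl i
def vI (i : Fin m) : BIdx m := if (i : ℕ) < m1 then Sum.inl i else Sum.inr i
noncomputable def ep (F : Type*) [Field F] (i : Fin m) : MvPolynomial (BIdx m) F :=
  if (i : ℕ) < m1 then 1 else -1

theorem ep_mul (i : Fin m) : ep m1 F i * ep m1 F i = 1 := by
  unfold ep; split_ifs <;> simp

theorem ep_mul' (i : Fin m) (f : MvPolynomial (BIdx m) F) :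
    ep m1 F i * (ep m1 F i * f) = f := by
  rw [← mul_assoc, ep_mul, one_mul]

theorem ep_der (D : Derivation F (MvPolynomial (BIdx m) F) (MvPolynomial (BIdx m) F)) (i : Fin m) :
    D (ep m1 F i) = 0 := by
  unfold ep; split_ifs <;> simp

variable (F) in
noncomputable def U (i : Fin m) : MvPolynomial (BIdx m) F := X (uI m1 i)
variable (F) in
noncomputable def V (i : Fin m) : MvPolynomial (BIdx m) F := ep m1 F i * X (vI m1 i)
variable (F) in
noncomputable def DU (i : Fin m) :
    Derivation F (MvPolynomial (BIdx m) F) (MvPolynomial (BIdx m) F) := pderiv (uI m1 i)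
variable (F) in
noncomputable def DV (i : Fin m) :
    Derivation F (MvPolynomial (BIdx m) F) (MvPolynomial (BIdx m) F) :=
  ep m1 F i • pderiv (vI m1 i)

theorem uI_inj (i j : Fin m) : uI m1 i = uI m1 j ↔ i = j := by
  unfold uI; constructor
  · split_ifs <;> simp
  · rintro rfl; rfl
theorem vI_inj (i j : Fin m) : vI m1 i = vI m1 j ↔ i = j := by
  unfold vI; constructor
  · split_ifs <;> simp
  · rintro rfl; rfl
theorem uI_vI (i j : Fin m) : uI m1 i ≠ vI m1 j := by
  unfold uI vI
  split_ifs <;> simp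
  · rintro rfl; contradiction
  · rintro rfl; contradiction

theorem DU_U (i j : Fin m) : DU F m1 i (U F m1 j) = if i = j then 1 else 0 := by
  unfold DU U
  split_ifs with h
  · subst h; simp
  · rw [pderiv_X_of_ne]; rw [Ne, uI_inj]; exact fun h' => h h'.symm
theorem DU_V (i j : Fin m) : DU F m1 i (V F m1 j) = 0 := by
  unfold V; rw [Derivation.leibniz, ep_der]; unfold DU
  rw [pderiv_X_of_ne (uI_vI m1 i j).symm]; simp
theorem DV_U (i j : Fin m) : DV F m1 i (U F m1 j) = 0 := by
  unfold DV U; rw [Derivation.smul_apply, pderiv_X_of_ne (uI_vI m1 j i)]; simp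
theorem DV_V (i j : Fin m) : DV F m1 i (V F m1 j) = if i = j then 1 else 0 := by
  unfold V; rw [Derivation.leibniz, ep_der]; unfold DV
  split_ifs with h
  · subst h; simp [ep_mul]
  · rw [Derivation.smul_apply, pderiv_X_of_ne]; · simp
    rw [Ne, vI_inj]; exact fun h' => h h'.symm

theorem BIdx_cases (b : BIdx m) : (∃ i, b = uI m1 i) ∨ ∃ i, b = vI m1 i := by
  rcases b with i | i <;> by_cases h : (i : ℕ) < m1
  · right; exact ⟨i, by simp [vI, h]⟩
  · left; exact ⟨i, by simp [uI, h]⟩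
  · left; exact ⟨i, by simp [uI, h]⟩
  · right; exact ⟨i, by simp [vI, h]⟩

theorem X_cases (b : BIdx m) : (∃ i, (X b : MvPolynomial (BIdx m) F) = U F m1 i) ∨
    ∃ i, (X b : MvPolynomial (BIdx m) F) = ep m1 F i * V F m1 i := by
  rcases BIdx_cases m1 b with ⟨i, rfl⟩ | ⟨i, rfl⟩
  · left; exact ⟨i, rfl⟩
  · right; exact ⟨i, by rw [V, ep_mul']⟩

theorem der_ext {D E : Derivation F (MvPolynomial (BIdx m) F) (MvPolynomial (BIdx m) F)}
    (hU : ∀ i, D (U F m1 i) = E (U F m1 i)) (hV : ∀ i, D (V F m1 i) = E (V F m1 i)) : D = E := by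
  apply derivation_ext
  intro b
  rcases X_cases (F := F) m1 b with ⟨i, h⟩ | ⟨i, h⟩ <;> rw [h]
  · exact hU i
  · simp [Derivation.leibniz, ep_der, hV]

theorem ind {p : MvPolynomial (BIdx m) F → Prop} (hC : ∀ c, p (C c))
    (hadd : ∀ f g, p f → p g → p (f + g)) (hU : ∀ i f, p f → p (U F m1 i * f))
    (hV : ∀ i f, p f → p (V F m1 i * f)) (f) : p f := by
  have hm : ∀ f, p f → p (- f) → p (-f) := fun _ _ h => h
  have key : ∀ f, p f ∧ p (-f) := by
    intro f
    induction f using MvPolynomial.induction_on with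
    | C a => exact ⟨hC a, by rw [← C_neg]; exact hC _⟩
    | add f g hf hg => exact ⟨hadd _ _ hf.1 hg.1, by rw [neg_add]; exact hadd _ _ hf.2 hg.2⟩
    | mul_X f b hf =>
      rcases X_cases (F := F) m1 b with ⟨i, h⟩ | ⟨i, h⟩ <;> rw [h]
      · refine ⟨by rw [mul_comm]; exact hU _ _ hf.1, ?_⟩
        rw [mul_comm, ← mul_neg]; exact hU _ _ hf.2
      · have h1 := hV i _ hf.1
        have h2 := hV i _ hf.2
        unfold ep
        split_ifs
        · constructor
          · convert h1 using 1; ring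
          · convert h2 using 1; ring
        · constructor
          · convert h2 using 1; ring
          · convert h1 using 1; ring
  exact (key f).1

/-! the swap -/
variable (F m) in
noncomputable def sg : MvPolynomial (BIdx m) F →ₐ[F] MvPolynomial (BIdx m) F :=
  aeval (Sum.elim (fun i => ep m1 F i * X (Sum.inr i)) (fun i => ep m1 F i * X (Sum.inl i)))

theorem sg_ep (i : Fin m) : sg F m m1 (ep m1 F i) = ep m1 F i := by
  unfold ep; split_ifs <;> simp

theorem sg_U (i : Fin m) : sg F m m1 (U F m1 i) = V F m1 i := by
  unfold sg U V uI vI; split_ifs <;> simp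
theorem sg_V (i : Fin m) : sg F m m1 (V F m1 i) = U F m1 i := by
  unfold V; rw [map_mul, sg_ep]
  unfold sg U uI vI; split_ifs <;> simp [ep_mul']

theorem sg_D (f : MvPolynomial (BIdx m) F) : ∀ i,
    DU F m1 i (sg F m m1 f) = sg F m m1 (DV F m1 i f) ∧
    DV F m1 i (sg F m m1 f) = sg F m m1 (DU F m1 i f) := by
  induction f using ind m1 with
  | hC c => intro i; simp [MvPolynomial.algHom_C]
  | hadd f g hf hg => intro i; simp [hf i, hg i]
  | hU j f hf =>
    intro i
    simp only [map_mul, Derivation.leibniz, sg_U, (hf i).1, (hf i).2, map_add, smul_eq_mul,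
      DU_U, DU_V, DV_U, DV_V]
    split_ifs <;> simp
  | hV j f hf =>
    intro i
    simp only [map_mul, Derivation.leibniz, sg_V, (hf i).1, (hf i).2, map_add, smul_eq_mul,
      DU_U, DU_V, DV_U, DV_V]
    split_ifs <;> simp

theorem sg_sg (f : MvPolynomial (BIdx m) F) : sg F m m1 (sg F m m1 f) = f := by
  induction f using ind m1 with
  | hC c => simp [MvPolynomial.algHom_C]
  | hadd f g hf hg => simp [hf, hg]
  | hU j f hf => simp [hf, sg_U, sg_V]
  | hV j f hf => simp [hf, sg_U, sg_V]

/-! the Fischer form -/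
variable (F m) in
noncomputable def form : MvPolynomial (BIdx m) F →ₗ[F] MvPolynomial (BIdx m) F →ₗ[F] F :=
  (basisMonomials (BIdx m) F).constr F
    (fun d => ((∏ b, (d b).factorial : ℕ) : F) • lcoeff F d)

theorem form_monomial (d : BIdx m →₀ ℕ) (c : F) (f : MvPolynomial (BIdx m) F) :
    form F m (monomial d c) f = c * ((∏ b, (d b).factorial : ℕ) : F) * coeff d f := by
  have h : monomial d c = c • (basisMonomials (BIdx m) F) d := by
    rw [coe_basisMonomials, smul_monomial, smul_eq_mul, mul_one]
  rw [h, form, map_smul, Module.Basis.constr_basis]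
  simp [mul_assoc]

theorem form_X (b : BIdx m) (g f : MvPolynomial (BIdx m) F) :
    form F m (X b * g) f = form F m g (pderiv b f) := by
  induction g using MvPolynomial.induction_on' with
  | add p q hp hq => simp [mul_add, hp, hq]
  | monomial d c =>
    rw [X, monomial_mul, form_monomial, form_monomial, coeff_pderiv, one_mul, add_comm]
    have : (∏ b', ((d + Finsupp.single b 1 : BIdx m →₀ ℕ) b').factorial)
        = (d b + 1) * ∏ b', (d b').factorial := by
      rw [← Finset.mul_prod_erase _ _ (Finset.mem_univ b),
        ← Finset.mul_prod_erase (Finset.univ) (fun b' => (d b').factorial) (Finset.mem_univ b)]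
      rw [Finset.prod_congr rfl (g := fun b' => (d b').factorial)]
      · simp [Nat.factorial_succ, mul_assoc]
      · intro x hx
        have : b ≠ x := fun h => by simp [h] at hx
        simp [this]
    rw [this]; push_cast; ring

theorem form_ep (i : Fin m) (g f : MvPolynomial (BIdx m) F) :
    form F m (ep m1 F i * g) f = form F m g (ep m1 F i * f) := by
  unfold ep; split_ifs <;> simp

theorem form_U (i : Fin m) (g f : MvPolynomial (BIdx m) F) :
    form F m (U F m1 i * g) f = form F m g (DU F m1 i f) := form_X _ _ _
theorem form_V (i : Fin m) (g f : MvPolynomial (BIdx m) F) :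
    form F m (V F m1 i * g) f = form F m g (DV F m1 i f) := by
  rw [V, mul_assoc, form_ep, form_X, Derivation.leibniz, ep_der]; simp [DV]

theorem form_C (c : F) (f : MvPolynomial (BIdx m) F) : form F m (C c) f = c * coeff 0 f := by
  rw [← monomial_zero', form_monomial]; simp

theorem form_nondeg [CharZero F] (f : MvPolynomial (BIdx m) F)
    (h : ∀ d, form F m (monomial d 1) f = 0) : f = 0 := by
  ext d
  have := h d
  rw [form_monomial, one_mul] at this
  rcases mul_eq_zero.1 this with h | h
  · exact absurd (Nat.cast_eq_zero.1 h) (Finset.prod_ne_zero_iff.2 fun b _ => Nat.factorial_ne_zero _)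
  · simpa using h

theorem coeff0_sg (f : MvPolynomial (BIdx m) F) : coeff 0 (sg F m m1 f) = coeff 0 f := by
  induction f using ind m1 with
  | hC c => simp [MvPolynomial.algHom_C]
  | hadd f g hf hg => simp [hf, hg]
  | hU j f hf =>
    simp only [← constantCoeff_eq, map_mul, sg_U] at *; simp [U, V]
  | hV j f hf =>
    simp only [← constantCoeff_eq, map_mul, sg_V] at *; simp [U, V]

theorem form_sg (g : MvPolynomial (BIdx m) F) : ∀ f,
    form F m (sg F m m1 g) f = form F m g (sg F m m1 f) := by
  induction g using ind m1 with
  | hC c => intro f; simp [MvPolynomial.algHom_C, form_C, coeff0_sg]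
  | hadd f g hf hg => intro f; simp [hf, hg]
  | hU j g hg => intro f; rw [map_mul, sg_U, form_U, form_V, (sg_D m1 f j).1, hg]
  | hV j g hg => intro f; rw [map_mul, sg_V, form_U, form_V, (sg_D m1 f j).2, hg]

set_option linter.unusedSimpArgs false

theorem der_sum (D : Fin m → Derivation F (MvPolynomial (BIdx m) F) (MvPolynomial (BIdx m) F)) (f) :
    (∑ i, D i) f = ∑ i, D i f := by
  have := congrFun (map_sum Derivation.coeFnAddMonoidHom D Finset.univ) f
  rw [Finset.sum_apply] at this
  exact this

/-! the twisted Euler operator -/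
variable (F m) in
noncomputable def Dt : Derivation F (MvPolynomial (BIdx m) F) (MvPolynomial (BIdx m) F) :=
  ∑ i, (U F m1 i • DU F m1 i - V F m1 i • DV F m1 i)

theorem Dt_apply (f : MvPolynomial (BIdx m) F) : Dt F m m1 f =
    ∑ i, (X (uI m1 i) * pderiv (uI m1 i) f - X (vI m1 i) * pderiv (vI m1 i) f) := by
  unfold Dt
  rw [der_sum]
  refine Finset.sum_congr rfl fun i _ => ?_
  simp only [Derivation.sub_apply, Derivation.smul_apply, U, V, DU, DV, smul_eq_mul]
  rw [mul_mul_mul_comm, ep_mul, one_mul]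

theorem DtB_eq (f : MvPolynomial (BIdx m) F) : DtB F m m1 m1 f = Dt F m m1 f := by
  rw [Dt_apply]
  unfold DtB
  rw [← Finset.sum_add_distrib, LinearMap.sum_apply]
  refine Finset.sum_congr rfl fun i _ => ?_
  unfold uI vI
  split_ifs <;> simp [mxB, myB, dxB, dyB] <;> ring

theorem Dt_U (i : Fin m) : Dt F m m1 (U F m1 i) = U F m1 i := by
  unfold Dt
  rw [der_sum]
  simp [DU_U, DV_U]
theorem Dt_V (i : Fin m) : Dt F m m1 (V F m1 i) = - V F m1 i := by
  unfold Dt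
  rw [der_sum]
  simp [DU_V, DV_V]

theorem Dt_DU (i : Fin m) (f) : Dt F m m1 (DU F m1 i f) = DU F m1 i (Dt F m m1 f) - DU F m1 i f := by
  have : ⁅Dt F m m1, DU F m1 i⁆ = - DU F m1 i := by
    apply der_ext m1 <;> intro j <;>
      simp only [Derivation.commutator_apply, Dt_U, Dt_V, DU_U, DU_V, Derivation.neg_apply, map_neg]
    · split_ifs <;> simp
    · simp
  have := congrArg (fun D => D f) this
  simp only [Derivation.commutator_apply, Derivation.neg_apply] at this
  linear_combination this
theorem Dt_DV (i : Fin m) (f) : Dt F m m1 (DV F m1 i f) = DV F m1 i (Dt F m m1 f) + DV F m1 i f := by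
  have : ⁅Dt F m m1, DV F m1 i⁆ = DV F m1 i := by
    apply der_ext m1 <;> intro j <;>
      simp only [Derivation.commutator_apply, Dt_U, Dt_V, DV_U, DV_V, map_neg]
    · simp
    · split_ifs <;> simp
  have := congrArg (fun D => D f) this
  simp only [Derivation.commutator_apply] at this
  linear_combination this

theorem Dt_monomial (d : BIdx m →₀ ℕ) (c : F) : Dt F m m1 (monomial d c) =
    ((∑ i, ((d (uI m1 i) : ℤ) - (d (vI m1 i) : ℤ)) : ℤ) : F) • monomial d c := by
  rw [Dt_apply]
  push_cast
  rw [Finset.sum_smul]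
  refine Finset.sum_congr rfl fun i _ => ?_
  rw [X_mul_pderiv_monomial, X_mul_pderiv_monomial, sub_smul, Nat.cast_smul_eq_nsmul,
    Nat.cast_smul_eq_nsmul]

theorem coeff_Dt (f : MvPolynomial (BIdx m) F) (d) : coeff d (Dt F m m1 f) =
    ((∑ i, ((d (uI m1 i) : ℤ) - (d (vI m1 i) : ℤ)) : ℤ) : F) * coeff d f := by
  induction f using MvPolynomial.induction_on' with
  | add p q hp hq => rw [map_add, coeff_add, hp, hq, coeff_add, mul_add]
  | monomial e c =>
    rw [Dt_monomial, coeff_smul, smul_eq_mul]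
    by_cases h : e = d
    · rw [h]
    · simp [coeff_monomial, h]

/-! the operators -/
variable (F) in
noncomputable def P (i j : Fin m) : MvPolynomial (BIdx m) F :=
  U F m1 i * V F m1 j + U F m1 j * V F m1 i
variable (F) in
noncomputable def A (i j : Fin m) : MvPolynomial (BIdx m) F :=
  U F m1 i * V F m1 j - U F m1 j * V F m1 i
noncomputable def Q (i j : Fin m) (f : MvPolynomial (BIdx m) F) : MvPolynomial (BIdx m) F :=
  DU F m1 i (DV F m1 j f) + DU F m1 j (DV F m1 i f)
variable (F) in
noncomputable def E (i j : Fin m) :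
    Derivation F (MvPolynomial (BIdx m) F) (MvPolynomial (BIdx m) F) :=
  U F m1 i • DU F m1 j + V F m1 i • DV F m1 j

theorem E_apply (i j : Fin m) (f) :
    E F m1 i j f = U F m1 i * DU F m1 j f + V F m1 i * DV F m1 j f := rfl

theorem form_P (i j : Fin m) (g f : MvPolynomial (BIdx m) F) :
    form F m (P F m1 i j * g) f = form F m g (Q m1 i j f) := by
  have : P F m1 i j * g = V F m1 j * (U F m1 i * g) + V F m1 i * (U F m1 j * g) := by
    unfold P; ring
  rw [this, map_add, LinearMap.add_apply, form_V, form_V, form_U, form_U, Q, map_add]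

/-- invariance -/
structure Inv (W : Submodule F (MvPolynomial (BIdx m) F)) : Prop where
  hP : ∀ i j, ∀ f ∈ W, P F m1 i j * f ∈ W
  hQ : ∀ i j, ∀ f ∈ W, Q m1 i j f ∈ W
  hE : ∀ i j, ∀ f ∈ W, E F m1 i j f ∈ W

theorem pd_comm (a b : BIdx m) (f : MvPolynomial (BIdx m) F) :
    pderiv a (pderiv b f) = pderiv b (pderiv a f) := by
  ext d
  simp only [coeff_pderiv]
  by_cases h : a = b
  · rw [h]
  · simp [add_right_comm, Finsupp.single_apply, h, Ne.symm h]; ring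

theorem uI_lt {i : Fin m} (h : (i : ℕ) < m1) : uI m1 i = Sum.inr i := by simp [uI, h]
theorem uI_ge {i : Fin m} (h : ¬ (i : ℕ) < m1) : uI m1 i = Sum.inl i := by simp [uI, h]
theorem vI_lt {i : Fin m} (h : (i : ℕ) < m1) : vI m1 i = Sum.inl i := by simp [vI, h]
theorem vI_ge {i : Fin m} (h : ¬ (i : ℕ) < m1) : vI m1 i = Sum.inr i := by simp [vI, h]
theorem ep_lt {i : Fin m} (h : (i : ℕ) < m1) : ep m1 F i = 1 := by simp [ep, h]
theorem ep_ge {i : Fin m} (h : ¬ (i : ℕ) < m1) : ep m1 F i = -1 := by simp [ep, h]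

theorem Ex_LL {i j : Fin m} (hi : (i : ℕ) < m1) (hj : (j : ℕ) < m1) (f) :
    (ExB F m m1 i j - EyB F m m1 j i) f = - E F m1 j i f - if i = j then f else 0 := by
  rw [E_apply]
  simp only [ExB, EyB, U, V, DU, DV, hi, hj, uI_lt, vI_lt, ep_lt, if_true]
  split_ifs <;> simp [mxB, myB, dxB, dyB] <;> ring
theorem Ex_GG {i j : Fin m} (hi : ¬ (i : ℕ) < m1) (hj : ¬ (j : ℕ) < m1) (f) :
    (ExB F m m1 i j - EyB F m m1 j i) f = E F m1 i j f + if i = j then f else 0 := by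
  rw [E_apply]
  have h : (j = i) = (i = j) := propext eq_comm
  simp only [ExB, EyB, U, V, DU, DV, hi, hj, uI_ge, vI_ge, ep_ge, if_false, not_false_eq_true, h]
  split_ifs <;> simp [mxB, myB, dxB, dyB] <;> ring
theorem Ex_LG {i j : Fin m} (hi : (i : ℕ) < m1) (hj : ¬ (j : ℕ) < m1) (f) :
    (ExB F m m1 i j - EyB F m m1 j i) f = Q m1 i j f := by
  simp [ExB, EyB, Q, U, V, DU, DV, hi, hj, uI_ge, vI_ge, ep_ge, uI_lt, vI_lt, ep_lt,
    mxB, myB, dxB, dyB]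
  rw [pd_comm (Sum.inl i), pd_comm (Sum.inr i)]; ring
theorem Ex_GL {i j : Fin m} (hi : ¬ (i : ℕ) < m1) (hj : (j : ℕ) < m1) (f) :
    (ExB F m m1 i j - EyB F m m1 j i) f = - (P F m1 i j * f) := by
  simp [ExB, EyB, P, U, V, DU, DV, hi, hj, uI_ge, vI_ge, ep_ge, uI_lt, vI_lt, ep_lt,
    mxB, myB, dxB, dyB]
  ring
theorem Fo_LL {i j : Fin m} (hi : (i : ℕ) < m1) (hj : (j : ℕ) < m1) (f) :
    (FoB F m m1 m1 i j + FoB F m m1 m1 j i) f = Q m1 i j f := by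
  simp [FoB, Q, U, V, DU, DV, hi, hj, uI_lt, vI_lt, ep_lt, mxB, myB, dxB, dyB]
  rw [pd_comm (Sum.inl i), pd_comm (Sum.inl j)]; ring
theorem Fo_GG {i j : Fin m} (hi : ¬ (i : ℕ) < m1) (hj : ¬ (j : ℕ) < m1) (f) :
    (FoB F m m1 m1 i j + FoB F m m1 m1 j i) f = P F m1 i j * f := by
  simp [FoB, P, U, V, DU, DV, hi, hj, uI_ge, vI_ge, ep_ge, mxB, myB, dxB, dyB]
  ring
theorem Fo_LG {i j : Fin m} (hi : (i : ℕ) < m1) (hj : ¬ (j : ℕ) < m1) (f) :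
    (FoB F m m1 m1 i j + FoB F m m1 m1 j i) f = E F m1 j i f := by
  rw [E_apply]
  simp [FoB, Q, U, V, DU, DV, hi, hj, uI_ge, vI_ge, ep_ge, uI_lt, vI_lt, ep_lt,
    mxB, myB, dxB, dyB]
  ring
theorem Go_LL {i j : Fin m} (hi : (i : ℕ) < m1) (hj : (j : ℕ) < m1) (f) :
    (GoB F m m1 m1 i j + GoB F m m1 m1 j i) f = - (P F m1 i j * f) := by
  simp [GoB, P, U, V, DU, DV, hi, hj, uI_lt, vI_lt, ep_lt, mxB, myB, dxB, dyB]
  ring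
theorem Go_GG {i j : Fin m} (hi : ¬ (i : ℕ) < m1) (hj : ¬ (j : ℕ) < m1) (f) :
    (GoB F m m1 m1 i j + GoB F m m1 m1 j i) f = - Q m1 i j f := by
  simp [GoB, Q, U, V, DU, DV, hi, hj, uI_ge, vI_ge, ep_ge, mxB, myB, dxB, dyB]
theorem Go_LG {i j : Fin m} (hi : (i : ℕ) < m1) (hj : ¬ (j : ℕ) < m1) (f) :
    (GoB F m m1 m1 i j + GoB F m m1 m1 j i) f = E F m1 i j f := by
  rw [E_apply]
  simp [GoB, Q, U, V, DU, DV, hi, hj, uI_ge, vI_ge, ep_ge, uI_lt, vI_lt, ep_lt,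
    mxB, myB, dxB, dyB]

theorem P_symm (i j : Fin m) : P F m1 i j = P F m1 j i := by unfold P; ring
theorem Q_symm (i j : Fin m) (f : MvPolynomial (BIdx m) F) : Q m1 i j f = Q m1 j i f := by
  unfold Q; ring

theorem inv_iff (W : Submodule F (MvPolynomial (BIdx m) F)) :
    (∀ T ∈ KOpsT F m m1 m1, ∀ f ∈ W, T f ∈ W) ↔ Inv m1 W := by
  constructor
  · intro h
    have hX : ∀ i j, ∀ f ∈ W, (ExB F m m1 i j - EyB F m m1 j i) f ∈ W :=
      fun i j => h _ (Or.inl ⟨i, j, rfl⟩)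
    have hF : ∀ i j, ∀ f ∈ W, (FoB F m m1 m1 i j + FoB F m m1 m1 j i) f ∈ W :=
      fun i j => h _ (Or.inr (Or.inl ⟨i, j, rfl⟩))
    have hG : ∀ i j, ∀ f ∈ W, (GoB F m m1 m1 i j + GoB F m m1 m1 j i) f ∈ W :=
      fun i j => h _ (Or.inr (Or.inr ⟨i, j, rfl⟩))
    refine ⟨fun i j f hf => ?_, fun i j f hf => ?_, fun i j f hf => ?_⟩ <;>
      by_cases hi : (i : ℕ) < m1 <;> by_cases hj : (j : ℕ) < m1
    · rw [← neg_neg (P F m1 i j * f), ← Go_LL m1 hi hj]; exact W.neg_mem (hG _ _ _ hf)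
    · rw [P_symm, ← neg_neg (P F m1 j i * f), ← Ex_GL m1 hj hi]; exact W.neg_mem (hX _ _ _ hf)
    · rw [← neg_neg (P F m1 i j * f), ← Ex_GL m1 hi hj]; exact W.neg_mem (hX _ _ _ hf)
    · rw [← Fo_GG m1 hi hj]; exact hF _ _ _ hf
    · rw [← Fo_LL m1 hi hj]; exact hF _ _ _ hf
    · rw [← Ex_LG m1 hi hj]; exact hX _ _ _ hf
    · rw [Q_symm, ← Ex_LG m1 hj hi]; exact hX _ _ _ hf
    · rw [← neg_neg (Q m1 i j f), ← Go_GG m1 hi hj]; exact W.neg_mem (hG _ _ _ hf)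
    · have := Ex_LL m1 hj hi f
      have h2 : E F m1 i j f = - (if j = i then f else 0) - (ExB F m m1 j i - EyB F m m1 i j) f := by
        rw [this]; ring
      rw [h2]
      refine W.sub_mem (W.neg_mem ?_) (hX _ _ _ hf)
      split_ifs; exacts [hf, W.zero_mem]
    · rw [← Go_LG m1 hi hj]; exact hG _ _ _ hf
    · rw [← Fo_LG m1 hj hi]; exact hF _ _ _ hf
    · have := Ex_GG m1 hi hj f
      have h2 : E F m1 i j f = (ExB F m m1 i j - EyB F m m1 j i) f - (if i = j then f else 0) := by
        rw [this]; ring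
      rw [h2]
      refine W.sub_mem (hX _ _ _ hf) ?_
      split_ifs; exacts [hf, W.zero_mem]
  · rintro ⟨hP, hQ, hE⟩ T hT f hf
    have hd : ∀ i j : Fin m, (if i = j then f else 0) ∈ W := by
      intro i j; split_ifs; exacts [hf, W.zero_mem]
    rcases hT with ⟨i, j, rfl⟩ | ⟨i, j, rfl⟩ | ⟨i, j, rfl⟩ <;>
      by_cases hi : (i : ℕ) < m1 <;> by_cases hj : (j : ℕ) < m1
    · rw [Ex_LL m1 hi hj]; exact W.sub_mem (W.neg_mem (hE _ _ _ hf)) (hd _ _)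
    · rw [Ex_LG m1 hi hj]; exact hQ _ _ _ hf
    · rw [Ex_GL m1 hi hj]; exact W.neg_mem (hP _ _ _ hf)
    · rw [Ex_GG m1 hi hj]; exact W.add_mem (hE _ _ _ hf) (hd _ _)
    · rw [Fo_LL m1 hi hj]; exact hQ _ _ _ hf
    · rw [Fo_LG m1 hi hj]; exact hE _ _ _ hf
    · rw [add_comm, Fo_LG m1 hj hi]; exact hE _ _ _ hf
    · rw [Fo_GG m1 hi hj]; exact hP _ _ _ hf
    · rw [Go_LL m1 hi hj]; exact W.neg_mem (hP _ _ _ hf)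
    · rw [Go_LG m1 hi hj]; exact hE _ _ _ hf
    · rw [add_comm, Go_LG m1 hj hi]; exact hE _ _ _ hf
    · rw [Go_GG m1 hi hj]; exact W.neg_mem (hQ _ _ _ hf)

variable (F m) in
noncomputable def Vp (s : F) : Submodule F (MvPolynomial (BIdx m) F) :=
  LinearMap.ker (Dt F m m1).toLinearMap ⊓ LinearMap.ker ((sg F m m1).toLinearMap - s • 1)

theorem mem_Vp {s : F} {f} : f ∈ Vp F m m1 s ↔ Dt F m m1 f = 0 ∧ sg F m m1 f = s • f := by
  simp [Vp, sub_eq_zero]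

theorem D_comm (i j : Fin m) (f : MvPolynomial (BIdx m) F) :
    DV F m1 i (DU F m1 j f) = DU F m1 j (DV F m1 i f) := by
  have : ⁅DV F m1 i, DU F m1 j⁆ = 0 := by
    apply der_ext m1 <;> intro k <;>
      simp only [Derivation.commutator_apply, DV_U, DV_V, DU_U, DU_V, Derivation.zero_apply, map_zero]
    · split_ifs <;> simp
    · split_ifs <;> simp
  have := congrArg (fun D => D f) this
  simp only [Derivation.commutator_apply, Derivation.zero_apply] at this
  exact sub_eq_zero.1 this

theorem Dt_P (i j : Fin m) : Dt F m m1 (P F m1 i j) = 0 := by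
  simp only [P, map_add, Derivation.leibniz, Dt_U, Dt_V, smul_eq_mul]; ring
theorem Dt_A (i j : Fin m) : Dt F m m1 (A F m1 i j) = 0 := by
  simp only [A, map_sub, Derivation.leibniz, Dt_U, Dt_V, smul_eq_mul]; ring
theorem sg_P (i j : Fin m) : sg F m m1 (P F m1 i j) = P F m1 i j := by
  simp only [P, map_add, map_mul, sg_U, sg_V]; ring
theorem sg_A (i j : Fin m) : sg F m m1 (A F m1 i j) = - A F m1 i j := by
  simp only [A, map_sub, map_mul, sg_U, sg_V]; ring

theorem inv_Vp (s : F) : Inv m1 (Vp F m m1 s) := by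
  refine ⟨fun i j f hf => ?_, fun i j f hf => ?_, fun i j f hf => ?_⟩ <;>
    rw [mem_Vp] at hf ⊢ <;> obtain ⟨h1, h2⟩ := hf
  · constructor
    · simp [Derivation.leibniz, Dt_P, h1]
    · rw [map_mul, sg_P, h2, mul_smul_comm]
  · constructor
    · simp [Q, Dt_DU, Dt_DV, h1]
    · rw [Q, map_add, ← (sg_D m1 _ i).2, ← (sg_D m1 _ j).1, ← (sg_D m1 _ j).2, ← (sg_D m1 _ i).1,
        h2, D_comm, D_comm]
      simp [Q, add_comm]
  · constructor
    · simp only [E_apply, map_add, Derivation.leibniz, Dt_U, Dt_V, Dt_DU, Dt_DV, h1, map_zero,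
        smul_eq_mul]; ring
    · simp only [E_apply, map_add, map_mul, sg_U, sg_V, ← (sg_D m1 _ j).1, ← (sg_D m1 _ j).2, h2,
        Derivation.map_smul, mul_smul_comm, smul_add]
      ring

variable (F m) in
noncomputable def Mon : Submonoid (MvPolynomial (BIdx m) F) :=
  Submonoid.closure {x | ∃ i j, x = P F m1 i j}

theorem Mon_ind {p : MvPolynomial (BIdx m) F → Prop} (h1 : p 1)
    (hP : ∀ i j x, x ∈ Mon F m m1 → p x → p (P F m1 i j * x)) {x} (hx : x ∈ Mon F m m1) : p x := by
  induction hx using Submonoid.closure_induction_left with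
  | one => exact h1
  | mul_left x hx y hy h =>
    obtain ⟨i, j, rfl⟩ := hx
    exact hP i j y hy h

theorem P_mem (i j : Fin m) : P F m1 i j ∈ Mon F m m1 := Submonoid.subset_closure ⟨i, j, rfl⟩

variable (F m) in
noncomputable def S1 : Submodule F (MvPolynomial (BIdx m) F) :=
  Submodule.span F (Mon F m m1 : Set (MvPolynomial (BIdx m) F))
variable (F m) in
noncomputable def S2 : Submodule F (MvPolynomial (BIdx m) F) :=
  Submodule.span F {x | ∃ i j, ∃ q ∈ Mon F m m1, x = A F m1 i j * q}

theorem span_mul {s : Set (MvPolynomial (BIdx m) F)} {S : Submodule F (MvPolynomial (BIdx m) F)}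
    (g) (h : ∀ x ∈ s, g * x ∈ S) : ∀ f ∈ Submodule.span F s, g * f ∈ S := by
  intro f hf
  have : Submodule.span F s ≤ S.comap (LinearMap.mulLeft F g) := Submodule.span_le.2 h
  exact this hf

theorem P_S1 (i j : Fin m) : ∀ f ∈ S1 F m m1, P F m1 i j * f ∈ S1 F m m1 :=
  span_mul _ fun x hx => Submodule.subset_span ((Mon F m m1).mul_mem (P_mem m1 i j) hx)
theorem P_S2 (i j : Fin m) : ∀ f ∈ S2 F m m1, P F m1 i j * f ∈ S2 F m m1 := by
  apply span_mul
  rintro x ⟨k, l, q, hq, rfl⟩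
  refine Submodule.subset_span ⟨k, l, _, (Mon F m m1).mul_mem (P_mem m1 i j) hq, by ring⟩
theorem A_S1 (i j : Fin m) : ∀ f ∈ S1 F m m1, A F m1 i j * f ∈ S2 F m m1 :=
  span_mul _ fun x hx => Submodule.subset_span ⟨i, j, x, hx, rfl⟩
theorem A_S2 (i j : Fin m) : ∀ f ∈ S2 F m m1, A F m1 i j * f ∈ S1 F m m1 := by
  apply span_mul
  rintro x ⟨k, l, q, hq, rfl⟩
  have : A F m1 i j * (A F m1 k l * q) = P F m1 i l * (P F m1 j k * q) - P F m1 i k * (P F m1 j l * q) := by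
    unfold A P; ring
  rw [this]
  have hq' : q ∈ S1 F m m1 := Submodule.subset_span hq
  exact Submodule.sub_mem _ (P_S1 _ _ _ _ (P_S1 _ _ _ _ hq')) (P_S1 _ _ _ _ (P_S1 _ _ _ _ hq'))

theorem UV_S [CharZero F] (i j : Fin m) (f) (hf : f ∈ S1 F m m1 ⊔ S2 F m m1) :
    U F m1 i * V F m1 j * f ∈ S1 F m m1 ⊔ S2 F m m1 := by
  obtain ⟨g, hg, h, hh, rfl⟩ := Submodule.mem_sup.1 hf
  have : U F m1 i * V F m1 j * (g + h) =
      (2⁻¹ : F) • ((P F m1 i j * g + A F m1 i j * h) + (P F m1 i j * h + A F m1 i j * g)) := by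
    have h2 : (P F m1 i j * g + A F m1 i j * h) + (P F m1 i j * h + A F m1 i j * g) =
      (2 : F) • (U F m1 i * V F m1 j * (g + h)) := by
      rw [two_smul]; unfold P A; ring
    rw [h2, smul_smul, inv_mul_cancel₀ two_ne_zero, one_smul]
  rw [this]
  exact Submodule.smul_mem _ _ (Submodule.add_mem _
    (Submodule.mem_sup_left (Submodule.add_mem _ (P_S1 _ _ _ _ hg) (A_S2 _ _ _ _ hh)))
    (Submodule.mem_sup_right (Submodule.add_mem _ (P_S2 _ _ _ _ hh) (A_S1 _ _ _ _ hg))))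

theorem one_S1 : (1 : MvPolynomial (BIdx m) F) ∈ S1 F m m1 := Submodule.subset_span (one_mem _)

theorem ep_mem (S : Submodule F (MvPolynomial (BIdx m) F)) (i : Fin m) (f) (hf : f ∈ S) :
    ep m1 F i * f ∈ S := by
  unfold ep; split_ifs
  · simpa using hf
  · simpa using hf

theorem mono_S [CharZero F] (n : ℕ) : ∀ d : BIdx m →₀ ℕ, d.degree = n →
    ∑ i, ((d (uI m1 i) : ℤ) - (d (vI m1 i) : ℤ)) = 0 →
    (monomial d 1 : MvPolynomial (BIdx m) F) ∈ S1 F m m1 ⊔ S2 F m m1 := by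
  induction n using Nat.strong_induction_on with
  | _ n ih =>
  intro d hd hw
  by_cases h0 : d = 0
  · rw [h0]; exact Submodule.mem_sup_left (one_S1 m1)
  have hw' : ∑ i : Fin m, d (uI m1 i) = ∑ i : Fin m, d (vI m1 i) := by
    rw [Finset.sum_sub_distrib, sub_eq_zero] at hw; exact_mod_cast hw
  have hex : (∃ i, d (uI m1 i) ≠ 0) ∧ (∃ i, d (vI m1 i) ≠ 0) := by
    by_cases hu : ∃ i, d (uI m1 i) ≠ 0
    · refine ⟨hu, ?_⟩
      by_contra hv
      push Not at hv
      rw [Finset.sum_eq_zero (fun i _ => hv i), Finset.sum_eq_zero_iff] at hw'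
      obtain ⟨i, hi⟩ := hu
      exact hi (hw' i (Finset.mem_univ _))
    · exfalso
      push Not at hu
      rw [Finset.sum_eq_zero (fun i _ => hu i), eq_comm, Finset.sum_eq_zero_iff] at hw'
      apply h0
      ext b
      rcases BIdx_cases m1 b with ⟨i, rfl⟩ | ⟨i, rfl⟩
      · exact hu i
      · exact hw' i (Finset.mem_univ _)
  obtain ⟨⟨i, hi⟩, j, hj⟩ := hex
  obtain ⟨e, he⟩ : ∃ e : BIdx m →₀ ℕ, d = Finsupp.single (uI m1 i) 1 + (Finsupp.single (vI m1 j) 1 + e) := by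
    refine ⟨d - (Finsupp.single (uI m1 i) 1 + Finsupp.single (vI m1 j) 1), ?_⟩
    rw [← add_assoc, add_tsub_cancel_of_le]
    intro b
    have := uI_vI m1 i j
    by_cases h1 : uI m1 i = b
    · subst h1; simp [Finsupp.single_apply, this.symm]; omega
    · by_cases h2 : vI m1 j = b
      · subst h2; simp [Finsupp.single_apply, this]; omega
      · simp [Finsupp.single_apply, h1, h2]
  have hmon : (monomial d 1 : MvPolynomial (BIdx m) F)
      = ep m1 F j * (U F m1 i * V F m1 j * monomial e 1) := by
    have h1 : (monomial d 1 : MvPolynomial (BIdx m) F) =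
      X (uI m1 i) * (X (vI m1 j) * monomial e 1) := by
      rw [he, X, X, monomial_mul, monomial_mul]; simp
    rw [h1, U, V]
    linear_combination (- X (uI m1 i) * X (vI m1 j) * monomial e 1) * ep_mul (F := F) m1 j
  rw [hmon]
  apply ep_mem
  apply UV_S
  refine ih e.degree ?_ e rfl ?_
  · rw [← hd, he]; simp; omega
  · rw [← hw, he]
    simp only [Finsupp.add_apply, Finsupp.single_apply, uI_inj, vI_inj, uI_vI, (uI_vI m1 _ _).symm,
      if_false]
    simp [Finset.sum_add_distrib, Finset.sum_sub_distrib]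

theorem ker_le [CharZero F] (f) (hf : Dt F m m1 f = 0) : f ∈ S1 F m m1 ⊔ S2 F m m1 := by
  rw [f.as_sum]
  refine Submodule.sum_mem _ fun d hd => ?_
  have h := coeff_Dt m1 f d
  rw [hf, coeff_zero, eq_comm, mul_eq_zero, Int.cast_eq_zero] at h
  have h' := mono_S (F := F) m1 _ d rfl (h.resolve_right (mem_support_iff.1 hd))
  have : monomial d (coeff d f) = coeff d f • (monomial d 1 : MvPolynomial (BIdx m) F) := by
    rw [smul_monomial, smul_eq_mul, mul_one]
  rw [this]; exact Submodule.smul_mem _ _ h'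

theorem S1_le : S1 F m m1 ≤ Vp F m m1 1 := by
  apply Submodule.span_le.2
  intro x hx
  exact Mon_ind m1 (p := fun x => x ∈ Vp F m m1 1) (by rw [mem_Vp]; simp)
    (fun i j x _ h => (inv_Vp m1 1).hP i j x h) hx

theorem S2_le : S2 F m m1 ≤ Vp F m m1 (-1) := by
  apply Submodule.span_le.2
  rintro _ ⟨i, j, x, hx, rfl⟩
  have := (mem_Vp m1).1 (S1_le m1 (Submodule.subset_span hx))
  show _ ∈ Vp F m m1 (-1)
  rw [mem_Vp]
  simp [Derivation.leibniz, Dt_A, sg_A, this.1, this.2]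

theorem Vp_inf [CharZero F] {f} (h1 : f ∈ Vp F m m1 1) (h2 : f ∈ Vp F m m1 (-1)) : f = 0 := by
  have h1 := ((mem_Vp m1).1 h1).2
  have h2 := ((mem_Vp m1).1 h2).2
  rw [h1] at h2
  simp only [one_smul, neg_smul] at h2
  exact self_eq_neg.1 h2

theorem Vp_one [CharZero F] : Vp F m m1 1 = S1 F m m1 := by
  refine le_antisymm (fun f hf => ?_) (S1_le m1)
  obtain ⟨g, hg, h, hh, rfl⟩ := Submodule.mem_sup.1 (ker_le m1 f ((mem_Vp m1).1 hf).1)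
  have : h = 0 := Vp_inf m1 (by simpa using Submodule.sub_mem _ hf (S1_le m1 hg)) (S2_le m1 hh)
  rw [this, add_zero]; exact hg

theorem Vp_neg [CharZero F] : Vp F m m1 (-1) = S2 F m m1 := by
  refine le_antisymm (fun f hf => ?_) (S2_le m1)
  obtain ⟨g, hg, h, hh, rfl⟩ := Submodule.mem_sup.1 (ker_le m1 f ((mem_Vp m1).1 hf).1)
  have : g = 0 := Vp_inf m1 (S1_le m1 hg) (by simpa using Submodule.sub_mem _ hf (S2_le m1 hh))
  rw [this, zero_add]; exact hh

theorem form_orth [CharZero F] {s : F} (hs : s ≠ 0) {f g} (hf : f ∈ Vp F m m1 s)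
    (hg : g ∈ Vp F m m1 (-s)) : form F m g f = 0 := by
  have := form_sg m1 g f
  rw [((mem_Vp m1).1 hf).2, ((mem_Vp m1).1 hg).2] at this
  simp only [map_smul, LinearMap.smul_apply, smul_eq_mul, neg_mul] at this
  have h := neg_eq_self.1 this
  exact (mul_eq_zero.1 h).resolve_left hs

theorem perp [CharZero F] {f} (hf : Dt F m m1 f = 0) (h1 : ∀ g ∈ S1 F m m1, form F m g f = 0)
    (h2 : ∀ g ∈ S2 F m m1, form F m g f = 0) : f = 0 := by
  apply form_nondeg
  intro d
  have h := coeff_Dt m1 f d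
  rw [hf, coeff_zero, eq_comm, mul_eq_zero, Int.cast_eq_zero] at h
  rcases h with h | h
  · obtain ⟨a, ha, b, hb, hab⟩ := Submodule.mem_sup.1 (mono_S (F := F) m1 _ d rfl h)
    rw [← hab, map_add, LinearMap.add_apply, h1 a ha, h2 b hb, add_zero]
  · rw [form_monomial, h, mul_zero]

theorem euler {n : ℕ} {f : MvPolynomial (BIdx m) F} (hf : f.IsHomogeneous n) :
    ∑ i, E F m1 i i f = (n : F) • f := by
  rw [Nat.cast_smul_eq_nsmul, ← hf.sum_X_mul_pderiv, Fintype.sum_sum_type, ← Finset.sum_add_distrib]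
  refine Finset.sum_congr rfl fun i _ => ?_
  rw [E_apply]
  simp only [U, V, DU, DV, Derivation.smul_apply, smul_eq_mul]
  rw [mul_mul_mul_comm, ep_mul, one_mul]
  unfold uI vI
  split_ifs <;> ring

theorem eig_mem {M : Type*} [AddCommGroup M] [Module F M] [CharZero F] (L : M →ₗ[F] M)
    (W : Submodule F M) (hL : ∀ x ∈ W, L x ∈ W) (s : Finset ℕ) :
    ∀ g : ℕ → M, (∀ n, L (g n) = (n : F) • g n) → ∑ n ∈ s, g n ∈ W → ∀ n ∈ s, g n ∈ W := by
  induction s using Finset.induction_on with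
  | empty => simp
  | insert a s ha ih =>
    intro g hg hs
    have hE := hL _ hs
    have h2 : L (∑ n ∈ insert a s, g n) = ∑ n ∈ insert a s, (n : F) • g n := by
      rw [map_sum]
      exact Finset.sum_congr rfl fun n _ => hg n
    rw [h2] at hE
    have h3 := W.sub_mem hE (W.smul_mem (a : F) hs)
    rw [Finset.smul_sum, ← Finset.sum_sub_distrib, Finset.sum_insert ha, sub_self, zero_add] at h3
    simp only [← sub_smul] at h3
    have h4 := ih (fun n => ((n : F) - a) • g n) (fun n => by
      rw [map_smul, hg, smul_comm]) h3
    have h5 : ∀ n ∈ s, g n ∈ W := by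
      intro n hn
      have hne : (n : F) - a ≠ 0 := by
        rw [sub_ne_zero]; intro h
        exact ha (Nat.cast_injective h ▸ hn)
      exact (Submodule.smul_mem_iff _ hne).1 (h4 n hn)
    intro n hn
    rcases Finset.mem_insert.1 hn with rfl | hn
    · rw [Finset.sum_insert ha] at hs
      have := W.sub_mem hs (W.sum_mem h5)
      rwa [add_sub_cancel_right] at this
    · exact h5 n hn

theorem comp_mem [CharZero F] {W : Submodule F (MvPolynomial (BIdx m) F)} (hW : Inv m1 W) {f}
    (hf : f ∈ W) (n : ℕ) : homogeneousComponent n f ∈ W := by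
  have hL : ∀ f, (∑ i : Fin m, (E F m1 i i).toLinearMap) f = ∑ i, E F m1 i i f := by
    intro f; rw [LinearMap.sum_apply]; rfl
  by_cases hn : n ∈ Finset.range (f.totalDegree + 1)
  · refine eig_mem (∑ i : Fin m, (E F m1 i i).toLinearMap) W ?_ _
      (fun n => homogeneousComponent n f) ?_ (by rw [sum_homogeneousComponent]; exact hf) n hn
    · intro x hx
      rw [hL]
      exact Submodule.sum_mem _ fun i _ => hW.hE i i _ hx
    · intro n
      rw [hL]
      exact euler m1 (homogeneousComponent_isHomogeneous n f)
  · rw [homogeneousComponent_eq_zero]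
    · exact W.zero_mem
    · simp at hn; omega

theorem irr1 [CharZero F] (W : Submodule F (MvPolynomial (BIdx m) F)) (hle : W ≤ Vp F m m1 1)
    (hW : Inv m1 W) : W = ⊥ ∨ W = Vp F m m1 1 := by
  by_cases h1 : (1 : MvPolynomial (BIdx m) F) ∈ W
  · right
    refine le_antisymm hle ?_
    rw [Vp_one]
    exact Submodule.span_le.2 fun x hx => Mon_ind m1 (p := fun x => x ∈ W) h1
      (fun i j x _ h => hW.hP i j x h) hx
  · left
    rw [eq_bot_iff]
    have hc : ∀ f ∈ W, coeff 0 f = 0 := by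
      intro f hf
      by_contra hne
      apply h1
      have := comp_mem m1 hW hf 0
      rw [homogeneousComponent_zero, ← mul_one (C (coeff 0 f)), ← smul_eq_C_mul] at this
      exact (Submodule.smul_mem_iff _ hne).1 this
    have hq : ∀ q ∈ Mon F m m1, ∀ f ∈ W, form F m q f = 0 := by
      intro q hq
      refine Mon_ind m1 (p := fun q => ∀ f ∈ W, form F m q f = 0) ?_ ?_ hq
      · intro f hf; rw [← C_1, form_C, hc f hf, mul_zero]
      · intro i j x _ h f hf
        rw [form_P]; exact h _ (hW.hQ _ _ _ hf)
    intro f hf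
    refine perp m1 ((mem_Vp m1).1 (hle hf)).1 (fun g hg => ?_)
      (fun g hg => form_orth m1 one_ne_zero (hle hf) (S2_le m1 hg))
    have : S1 F m m1 ≤ LinearMap.ker ((form F m).flip f) :=
      Submodule.span_le.2 fun q h => hq q h f hf
    exact this hg

theorem hom_U (i : Fin m) : (U F m1 i).IsHomogeneous 1 := isHomogeneous_X _ _
theorem hom_V (i : Fin m) : (V F m1 i).IsHomogeneous 1 := by
  have : (ep m1 F i).IsHomogeneous 0 := by
    unfold ep; split_ifs
    · exact isHomogeneous_one _ _
    · exact (isHomogeneous_one _ _).neg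
  unfold V; simpa using this.mul (isHomogeneous_X F (vI m1 i))
theorem hom_P (i j : Fin m) : (P F m1 i j).IsHomogeneous 2 :=
  ((hom_U m1 i).mul (hom_V m1 j)).add ((hom_U m1 j).mul (hom_V m1 i))
theorem hom_A (i j : Fin m) : (A F m1 i j).IsHomogeneous 2 :=
  ((hom_U m1 i).mul (hom_V m1 j)).sub ((hom_U m1 j).mul (hom_V m1 i))
theorem hom_Mon {x} (hx : x ∈ Mon F m m1) : ∃ n, x.IsHomogeneous n := by
  refine Mon_ind m1 (p := fun x => ∃ n, x.IsHomogeneous n) ⟨0, isHomogeneous_one _ _⟩ ?_ hx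
  rintro i j x _ ⟨n, h⟩
  exact ⟨_, (hom_P m1 i j).mul h⟩

theorem cc_U (i : Fin m) : constantCoeff (U F m1 i) = 0 := by simp [U]
theorem cc_V (i : Fin m) : constantCoeff (V F m1 i) = 0 := by simp [V]

theorem form_UV (l k : Fin m) (f : MvPolynomial (BIdx m) F) :
    form F m (U F m1 l * V F m1 k) f = constantCoeff (DV F m1 k (DU F m1 l f)) := by
  rw [← mul_one (V F m1 k), form_U, form_V, ← C_1, form_C, one_mul, constantCoeff_eq]

theorem E_A (p q i j : Fin m) : E F m1 p q (A F m1 i j) =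
    (if q = i then A F m1 p j else 0) + if q = j then A F m1 i p else 0 := by
  simp only [E_apply, A, map_sub, Derivation.leibniz, DU_U, DU_V, DV_U, DV_V, smul_eq_mul]
  split_ifs <;> ring

theorem S2_two (k l p q : Fin m) (hqk : q ≠ k) (f) (hf : f ∈ S2 F m m1) :
    E F m1 p k (E F m1 q l (homogeneousComponent 2 f)) =
      form F m (U F m1 l * V F m1 k) f • A F m1 q p := by
  induction hf using Submodule.span_induction with
  | zero => simp
  | add f g _ _ hf hg => simp only [map_add, hf, hg, add_smul]
  | smul c f _ hf => simp only [map_smul, Derivation.map_smul, hf, smul_smul, smul_eq_mul]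
  | mem x hx =>
    obtain ⟨i, j, y, hy, rfl⟩ := hx
    have hone : E F m1 p k (E F m1 q l (homogeneousComponent 2 (A F m1 i j * 1))) =
      form F m (U F m1 l * V F m1 k) (A F m1 i j * 1) • A F m1 q p := by
      rw [mul_one, homogeneousComponent_of_mem (hom_A m1 i j), if_pos rfl, form_UV, E_A]
      have hAA : ∀ p q : Fin m, A F m1 p q = - A F m1 q p := by intro p q; unfold A; ring
      have hD : DV F m1 k (DU F m1 l (A F m1 i j)) =
          (if l = i then (if k = j then 1 else 0) else 0) -
            (if l = j then (if k = i then 1 else 0) else 0) := by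
        have h1 : DU F m1 l (A F m1 i j) =
            (if l = i then V F m1 j else 0) - (if l = j then V F m1 i else 0) := by
          simp only [A, map_sub, Derivation.leibniz, DU_U, DU_V, smul_eq_mul]
          split_ifs <;> simp
        rw [h1, map_sub, apply_ite (DV F m1 k), apply_ite (DV F m1 k), DV_V, DV_V, map_zero]
      rw [hD, map_add, apply_ite (E F m1 p k), apply_ite (E F m1 p k), E_A, E_A, if_neg hqk.symm,
        if_neg hqk.symm, hAA p q]
      split_ifs <;> simp
    refine Mon_ind m1 (p := fun y => E F m1 p k (E F m1 q l (homogeneousComponent 2 (A F m1 i j * y))) =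
      form F m (U F m1 l * V F m1 k) (A F m1 i j * y) • A F m1 q p) hone ?_ hy
    intro a b z hz _
    obtain ⟨n, hn⟩ := hom_Mon m1 hz
    rw [homogeneousComponent_of_mem ((hom_A m1 i j).mul ((hom_P m1 a b).mul hn)), if_neg (by omega),
      form_UV]
    simp only [A, P, map_sub, map_add, Derivation.leibniz, map_mul, smul_eq_mul, cc_U, cc_V]
    simp

theorem irr2 [CharZero F] (W : Submodule F (MvPolynomial (BIdx m) F)) (hle : W ≤ Vp F m m1 (-1))
    (hW : Inv m1 W) : W = ⊥ ∨ W = Vp F m m1 (-1) := by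
  by_cases h1 : ∃ f ∈ W, ∃ l k, form F m (U F m1 l * V F m1 k) f ≠ 0
  · right
    obtain ⟨f, hf, l, k, hne⟩ := h1
    have hA1 : ∀ q p, q ≠ k → A F m1 q p ∈ W := by
      intro q p hqk
      have := S2_two m1 k l p q hqk f (by rw [← Vp_neg]; exact hle hf)
      rw [← Submodule.smul_mem_iff _ hne, ← this]
      exact hW.hE _ _ _ (hW.hE _ _ _ (comp_mem m1 hW hf 2))
    have hA : ∀ q p, A F m1 q p ∈ W := by
      intro q p
      by_cases hq : q = k
      · by_cases hp : p = k
        · have : A F m1 q p = 0 := by rw [hq, hp, A, sub_self]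
          rw [this]; exact W.zero_mem
        · have : A F m1 q p = - A F m1 p q := by unfold A; ring
          rw [this]; exact W.neg_mem (hA1 _ _ hp)
      · exact hA1 _ _ hq
    refine le_antisymm hle ?_
    rw [Vp_neg]
    refine Submodule.span_le.2 ?_
    rintro _ ⟨i, j, x, hx, rfl⟩
    refine Mon_ind m1 (p := fun x => A F m1 i j * x ∈ W) (by rw [mul_one]; exact hA _ _)
      (fun a b x _ h => ?_) hx
    rw [mul_left_comm]; exact hW.hP _ _ _ h
  · left
    push Not at h1
    rw [eq_bot_iff]
    have hq : ∀ i j, ∀ q ∈ Mon F m m1, ∀ f ∈ W, form F m (A F m1 i j * q) f = 0 := by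
      intro i j q hq
      refine Mon_ind m1 (p := fun q => ∀ f ∈ W, form F m (A F m1 i j * q) f = 0) ?_ ?_ hq
      · intro f hf
        rw [mul_one, A, map_sub, LinearMap.sub_apply, h1 f hf, h1 f hf, sub_zero]
      · intro a b x _ h f hf
        rw [mul_left_comm, form_P]; exact h _ (hW.hQ _ _ _ hf)
    intro f hf
    refine perp m1 ((mem_Vp m1).1 (hle hf)).1
      (fun g hg => form_orth m1 (neg_ne_zero.2 one_ne_zero) (hle hf)
        (by rw [neg_neg]; exact S1_le m1 hg)) (fun g hg => ?_)
    have : S2 F m m1 ≤ LinearMap.ker ((form F m).flip f) := by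
      refine Submodule.span_le.2 ?_
      rintro _ ⟨i, j, x, hx, rfl⟩
      exact hq i j x hx f hf
    exact this hg

theorem A_ne {i j : Fin m} (h : i ≠ j) : A F m1 i j ≠ 0 := by
  intro h0
  have : DU F m1 i (DV F m1 j (A F m1 i j)) = 1 := by
    simp [A, Derivation.leibniz, DU_U, DU_V, DV_U, DV_V, h.symm]
  rw [h0] at this
  simp at this

end Osc

/-- when `1 ≤ m1 = m2 ≤ m` and `m ≥ 2`, the space `B_{⟨0⟩}` is the direct
sum of two nonzero invariant subspaces `V₁, V₂`, each of which has no nontrivial invariant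
subspaces. -/
theorem stmt_19 (F : Type*) [Field F] [CharZero F] (m m1 m2 : ℕ) (hm : 2 ≤ m)
    (hm1 : 1 ≤ m1) (h12 : m1 = m2) (h2m : m2 ≤ m) :
    ∃ V₁ V₂ : Submodule F (MvPolynomial (BIdx m) F),
      V₁ ≠ ⊥ ∧ V₂ ≠ ⊥ ∧
      V₁ ⊓ V₂ = ⊥ ∧ V₁ ⊔ V₂ = Bgr F m m1 m2 0 ∧
      (∀ T ∈ KOpsT F m m1 m2, ∀ f ∈ V₁, T f ∈ V₁) ∧
      (∀ T ∈ KOpsT F m m1 m2, ∀ f ∈ V₂, T f ∈ V₂) ∧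
      (∀ W : Submodule F (MvPolynomial (BIdx m) F), W ≤ V₁ →
        (∀ T ∈ KOpsT F m m1 m2, ∀ f ∈ W, T f ∈ W) → W = ⊥ ∨ W = V₁) ∧
      (∀ W : Submodule F (MvPolynomial (BIdx m) F), W ≤ V₂ →
        (∀ T ∈ KOpsT F m m1 m2, ∀ f ∈ W, T f ∈ W) → W = ⊥ ∨ W = V₂) := by
  subst h12
  refine ⟨Osc.Vp F m m1 1, Osc.Vp F m m1 (-1), ?_, ?_, ?_, ?_, ?_, ?_, ?_, ?_⟩
  · intro h
    have h1 := Osc.S1_le m1 (Osc.one_S1 (F := F) (m := m) m1)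
    rw [h, Submodule.mem_bot] at h1
    exact one_ne_zero h1
  · intro h
    have h1 := Osc.S2_le m1 (Osc.A_S1 (F := F) (m := m) m1 ⟨0, by omega⟩ ⟨1, by omega⟩ 1
      (Osc.one_S1 m1))
    rw [h, Submodule.mem_bot, mul_one] at h1
    exact Osc.A_ne m1 (by simp) h1
  · rw [eq_bot_iff]
    rintro f ⟨h1, h2⟩
    exact Osc.Vp_inf m1 h1 h2
  · ext f
    have hB : f ∈ Bgr F m m1 m1 0 ↔ Osc.Dt F m m1 f = 0 := by
      simp [Bgr, Osc.DtB_eq]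
    rw [hB]
    constructor
    · intro h
      obtain ⟨a, ha, b, hb, rfl⟩ := Submodule.mem_sup.1 h
      rw [map_add, ((Osc.mem_Vp m1).1 ha).1, ((Osc.mem_Vp m1).1 hb).1, add_zero]
    · intro h
      rw [Osc.Vp_one, Osc.Vp_neg]
      exact Osc.ker_le m1 f h
  · exact (Osc.inv_iff m1 _).2 (Osc.inv_Vp m1 1)
  · exact (Osc.inv_iff m1 _).2 (Osc.inv_Vp m1 (-1))
  · intro W hW h
    exact Osc.irr1 m1 W hW ((Osc.inv_iff m1 W).1 h)
  · intro W hW h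
    exact Osc.irr2 m1 W hW ((Osc.inv_iff m1 W).1 h)
end
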